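/- arXiv:1708.08781 — 7 statements merged into one kernel-verified Lean document; each statement's English description precedes it below -/
import Mathlib

section
/- Let F : 2^V → ℝ^E be a submodular transformation on a finite set V with |V| = n ≥ 2 such that F(∅) = F(V) = 0, F_e(S) ∈ [0,1] for every e ∈ E and S ⊆ V, and d_F(v) > 0 for every v ∈ V. Define λ_F = inf { ℛ_F(x) : x ∈ ℝ^V, x ≠ 0, ⟨x, D_F^{1/2} 1⟩ = 0 }, where 1 is the all-ones vector. Then λ_F / 2 ≤ φ_F ≤ 2 √λ_F. -/
open Finset

variable {V E : Type*}

/-- A set function on a finite ground set is submodular. -/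
def Submodular [DecidableEq V] (F : Finset V → ℝ) : Prop :=
  ∀ S T : Finset V, F (S ∪ T) + F (S ∩ T) ≤ F S + F T

/-- The base polytope of a set function. -/
def basePolytope [Fintype V] (F : Finset V → ℝ) : Set (V → ℝ) :=
  {w | (∀ S : Finset V, ∑ v ∈ S, w v ≤ F S) ∧ ∑ v, w v = F Finset.univ}

/-- The Lovász extension `f(x) = max_{w ∈ B(F)} ⟨w, x⟩`. -/
noncomputable def lovasz [Fintype V] (F : Finset V → ℝ) (x : V → ℝ) : ℝ :=
  sSup ((fun w : V → ℝ => ∑ v, w v * x v) '' basePolytope F)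

/-- `∂f(x) = argmax_{w ∈ B(F)} ⟨w, x⟩`. -/
def subdiff [Fintype V] (F : Finset V → ℝ) (x : V → ℝ) : Set (V → ℝ) :=
  {w | w ∈ basePolytope F ∧ ∀ w' ∈ basePolytope F, ∑ v, w' v * x v ≤ ∑ v, w v * x v}

/-- The submodular Laplacian, a set-valued map. -/
def laplacian [Fintype V] [Fintype E] (F : Finset V → E → ℝ) (x : V → ℝ) : Set (V → ℝ) :=
  {z | ∃ w : E → V → ℝ, (∀ e : E, w e ∈ subdiff (fun S => F S e) x) ∧
    z = fun v => ∑ e : E, (∑ u, w e u * x u) * w e v}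

/-- The support of a set function. -/
def funSupp [DecidableEq V] (G : Finset V → ℝ) : Set V :=
  {v | ∃ S : Finset V, v ∉ S ∧ G (insert v S) ≠ G S}

open Classical in
/-- The degree `d_F(v)` of `v`: the number of coordinate functions to which `v` is relevant. -/
noncomputable def deg [Fintype V] [Fintype E] [DecidableEq V]
    (F : Finset V → E → ℝ) (v : V) : ℝ :=
  ((Finset.univ : Finset E).filter (fun e => v ∈ funSupp (fun S => F S e))).card

/-- `cut_F(S) = ∑_e F_e(S)`. -/
def cutF [Fintype V] [Fintype E] (F : Finset V → E → ℝ) (S : Finset V) : ℝ := ∑ e : E, F S e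

/-- `vol_F(S) = ∑_{v ∈ S} d_F(v)`. -/
noncomputable def volF [Fintype V] [Fintype E] [DecidableEq V]
    (F : Finset V → E → ℝ) (S : Finset V) : ℝ :=
  ∑ v ∈ S, deg F v

/-- The conductance of a set `S`. -/
noncomputable def condOf [Fintype V] [Fintype E] [DecidableEq V]
    (F : Finset V → E → ℝ) (S : Finset V) : ℝ :=
  min (cutF F S) (cutF F Sᶜ) / min (volF F S) (volF F Sᶜ)

/-- The conductance `φ_F` of `F`: minimum over nonempty proper subsets. -/
noncomputable def conduct [Fintype V] [Fintype E] [DecidableEq V]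
    (F : Finset V → E → ℝ) : ℝ :=
  sInf {c | ∃ S : Finset V, S.Nonempty ∧ S ≠ Finset.univ ∧ c = condOf F S}

/-- The Rayleigh quotient of the normalized Laplacian. -/
noncomputable def rayleigh [Fintype V] [Fintype E] [DecidableEq V]
    (F : Finset V → E → ℝ) (x : V → ℝ) : ℝ :=
  (∑ e : E, (lovasz (fun S => F S e) (fun v => x v / Real.sqrt (deg F v)))^2) /
    (∑ v, (x v)^2)

/-- The smallest non-trivial eigenvalue `λ_F`, defined as the infimum of the Rayleigh quotient
over nonzero vectors orthogonal to `D_F^{1/2} 𝟏`. -/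
noncomputable def lambdaF [Fintype V] [Fintype E] [DecidableEq V]
    (F : Finset V → E → ℝ) : ℝ :=
  sInf {r | ∃ x : V → ℝ, x ≠ 0 ∧ (∑ v, x v * Real.sqrt (deg F v)) = 0 ∧ r = rayleigh F x}

section Helpers

lemma aux_abel {V : Type*} [Fintype V] [DecidableEq V] (W : V → ℝ) (n : ℕ) :
    ∀ x : V → ℝ, (∀ v, 0 ≤ x v) → (univ.filter (fun v => 0 < x v)).card ≤ n →
    (∀ S : Finset V, (∀ a ∈ S, ∀ b, x a ≤ x b → b ∈ S) → (∀ a ∈ S, 0 < x a) →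
      0 ≤ ∑ v ∈ S, W v) → 0 ≤ ∑ v, W v * x v := by
  induction n with
  | zero =>
    intro x hx hc _
    apply le_of_eq
    symm
    apply Finset.sum_eq_zero
    intro v _
    have h0 : univ.filter (fun v => 0 < x v) = ∅ := by
      rw [← Finset.card_eq_zero]; omega
    have hv : v ∉ univ.filter (fun v => 0 < x v) := by rw [h0]; simp
    simp at hv
    have : x v = 0 := le_antisymm hv (hx v)
    simp [this]
  | succ n ih =>
    intro x hx hc h
    set P := univ.filter (fun v => 0 < x v) with hP
    have memP : ∀ v, v ∈ P ↔ 0 < x v := by intro v; simp [hP]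
    by_cases hne : P.Nonempty
    · obtain ⟨m, hmP, hm⟩ := P.exists_min_image x hne
      have hmpos : 0 < x m := (memP m).1 hmP
      set y : V → ℝ := fun v => x v - if v ∈ P then x m else 0 with hy
      have hyP : ∀ v, v ∈ P → y v = x v - x m := by intro v hv; simp [hy, hv]
      have hyN : ∀ v, v ∉ P → y v = 0 := by
        intro v hv
        have h1 : ¬ 0 < x v := fun h => hv ((memP v).2 h)
        have h2 := hx v
        simp [hy, hv]; linarith
      have hy0 : ∀ v, 0 ≤ y v := by
        intro v
        by_cases hv : v ∈ P
        · rw [hyP v hv]; linarith [hm v hv]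
        · rw [hyN v hv]
      have hypos : ∀ v, 0 < y v → v ∈ P := by
        intro v hv
        by_contra hn
        rw [hyN v hn] at hv; exact lt_irrefl _ hv
      have hcard : (univ.filter (fun v => 0 < y v)).card ≤ n := by
        have hss : univ.filter (fun v => 0 < y v) ⊂ P := by
          rw [Finset.ssubset_iff_of_subset]
          · exact ⟨m, hmP, by simp [hyP m hmP]⟩
          · intro v hv
            exact hypos v (by simpa using hv)
        have := Finset.card_lt_card hss
        omega
      have key := ih y hy0 hcard (by
        intro S hS hpos
        apply h S
        · intro a ha b hab
          have haP := hypos a (hpos a ha)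
          have hbP : b ∈ P := (memP b).2 (lt_of_lt_of_le ((memP a).1 haP) hab)
          apply hS a ha b
          rw [hyP a haP, hyP b hbP]; linarith
        · intro a ha
          exact (memP a).1 (hypos a (hpos a ha)))
      have hWP := h P (by
        intro a ha b hab
        exact (memP b).2 (lt_of_lt_of_le ((memP a).1 ha) hab)) (fun a ha => (memP a).1 ha)
      have heq : ∑ v, W v * x v = ∑ v, W v * y v + (∑ v ∈ P, W v) * x m := by
        rw [Finset.sum_mul, ← Finset.sum_filter_add_sum_filter_not univ (fun v => v ∈ P)
          (fun v => W v * x v), ← Finset.sum_filter_add_sum_filter_not univ (fun v => v ∈ P)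
          (fun v => W v * y v)]
        have e1 : univ.filter (fun v => v ∈ P) = P := by ext; simp
        rw [e1]
        have e2 : ∑ v ∈ univ.filter (fun v => v ∉ P), W v * x v
            = ∑ v ∈ univ.filter (fun v => v ∉ P), W v * y v := by
          apply Finset.sum_congr rfl
          intro v hv
          have hv' : v ∉ P := by simpa using hv
          simp [hy, hv']
        have e3 : ∑ v ∈ P, W v * x v = ∑ v ∈ P, W v * y v + ∑ v ∈ P, W v * x m := by
          rw [← Finset.sum_add_distrib]
          apply Finset.sum_congr rfl
          intro v hv
          rw [hyP v hv]; ring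
        rw [e2, e3]; ring
      rw [heq]
      have := mul_nonneg hWP hmpos.le
      linarith
    · have hP0 : P = ∅ := Finset.not_nonempty_iff_eq_empty.1 hne
      exact ih x hx (by rw [← hP, hP0]; simp) h

lemma aux_abel' {V : Type*} [Fintype V] [DecidableEq V] (W : V → ℝ)
    (x : V → ℝ) (hx : ∀ v, 0 ≤ x v)
    (h : ∀ S : Finset V, (∀ a ∈ S, ∀ b, x a ≤ x b → b ∈ S) → (∀ a ∈ S, 0 < x a) →
      0 ≤ ∑ v ∈ S, W v) : 0 ≤ ∑ v, W v * x v :=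
  aux_abel W _ x hx le_rfl h

lemma aux_greedy {V : Type*} [Fintype V] [DecidableEq V] (G : Finset V → ℝ)
    (hG : Submodular G) (h0 : G ∅ = 0) (z : V → ℝ) :
    ∃ w ∈ basePolytope G, ∀ S : Finset V, (∀ a ∈ S, ∀ b, z a ≤ z b → b ∈ S) →
      ∑ v ∈ S, w v = G S := by
  let key : V → ℝ ×ₗ Fin (Fintype.card V) := fun v => toLex (z v, Fintype.equivFin V v)
  have key_inj : Function.Injective key := by
    intro a b hab
    have h1 : (z a, Fintype.equivFin V a) = (z b, Fintype.equivFin V b) := toLex.injective hab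
    exact (Fintype.equivFin V).injective (Prod.ext_iff.1 h1).2
  have key_z : ∀ a b, key a ≤ key b → z a ≤ z b := by
    intro a b hab
    rcases (Prod.Lex.toLex_le_toLex.1 hab) with h | h
    · exact le_of_lt h
    · exact le_of_eq h.1
  let U : V → Finset V := fun v => univ.filter (fun u => key v < key u)
  let w : V → ℝ := fun v => G (insert v (U v)) - G (U v)
  have hle : ∀ S : Finset V, ∑ v ∈ S, w v ≤ G S := by
    intro S
    induction S using Finset.induction_on_min_value key with
    | empty => simp [h0]
    | insert a s ha hmin ih =>
      rw [Finset.sum_insert ha]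
      have hs : s ⊆ U a := by
        intro b hb
        simp only [U, mem_filter, mem_univ, true_and]
        exact lt_of_le_of_ne (hmin b hb) (fun h => ha (by rw [key_inj h]; exact hb))
      have haU : a ∉ U a := by simp [U]
      have h1 := hG (insert a s) (U a)
      have e1 : insert a s ∪ U a = insert a (U a) := by
        rw [Finset.insert_union, Finset.union_eq_right.2 hs]
      have e2 : insert a s ∩ U a = s := by
        rw [Finset.insert_inter_of_notMem haU, Finset.inter_eq_left.2 hs]
      rw [e1, e2] at h1
      simp only [w] at ih ⊢
      linarith
  have heq : ∀ S : Finset V, (∀ a ∈ S, ∀ b, key a ≤ key b → b ∈ S) →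
      ∑ v ∈ S, w v = G S := by
    intro S
    induction S using Finset.induction_on_min_value key with
    | empty => simp [h0]
    | insert a s ha hmin ih =>
      intro hS
      rw [Finset.sum_insert ha]
      have hs : s = U a := by
        ext b
        simp only [U, mem_filter, mem_univ, true_and]
        constructor
        · intro hb
          exact lt_of_le_of_ne (hmin b hb) (fun h => ha (by rw [key_inj h]; exact hb))
        · intro hb
          have := hS a (Finset.mem_insert_self _ _) b hb.le
          rcases Finset.mem_insert.1 this with h | h
          · subst h; exact absurd hb (lt_irrefl _)
          · exact h
      have := ih (by
        intro c hc b hcb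
        rw [hs] at hc ⊢
        simp only [U, mem_filter, mem_univ, true_and] at hc ⊢
        exact lt_of_lt_of_le hc hcb)
      rw [this]
      simp only [w]
      rw [← hs]; ring
  refine ⟨w, ⟨hle, heq univ (by simp)⟩, ?_⟩
  intro S hS
  exact heq S (fun a ha b hab => hS a ha b (key_z a b hab))

lemma aux_lovasz {V : Type*} [Fintype V] [DecidableEq V] (G : Finset V → ℝ)
    (z w : V → ℝ) (hw : w ∈ basePolytope G)
    (ht : ∀ S : Finset V, (∀ a ∈ S, ∀ b, z a ≤ z b → b ∈ S) → ∑ v ∈ S, w v = G S) :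
    IsGreatest ((fun w : V → ℝ => ∑ v, w v * z v) '' basePolytope G) (∑ v, w v * z v) := by
  refine ⟨⟨w, hw, rfl⟩, ?_⟩
  rintro _ ⟨w', hw', rfl⟩
  simp only
  rcases isEmpty_or_nonempty V with hV | hV
  · simp
  obtain ⟨m, _, hm⟩ := (univ : Finset V).exists_min_image z Finset.univ_nonempty
  have h := aux_abel' (fun v => w v - w' v) (fun v => z v - z m)
    (fun v => by linarith [hm v (mem_univ v)]) (by
      intro S hS _
      rw [Finset.sum_sub_distrib, ht S (fun a ha b hab => hS a ha b (by linarith))]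
      linarith [hw'.1 S])
  have e : ∑ v, (w v - w' v) * (z v - z m)
      = ∑ v, w v * z v - ∑ v, w' v * z v - (∑ v, w v - ∑ v, w' v) * z m := by
    rw [sub_mul, Finset.sum_mul, Finset.sum_mul, ← Finset.sum_sub_distrib,
      ← Finset.sum_sub_distrib, ← Finset.sum_sub_distrib]
    exact Finset.sum_congr rfl (fun v _ => by ring)
  rw [e, hw.2, hw'.2] at h
  linarith

lemma aux_supp {V : Type*} [Fintype V] [DecidableEq V] (G : Finset V → ℝ)
    (h0 : G ∅ = 0) (w : V → ℝ) (hw : w ∈ basePolytope G)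
    (v : V) (hv : v ∉ funSupp G) : w v = 0 := by
  have hv' : ∀ S : Finset V, v ∉ S → G (insert v S) = G S := by
    intro S hS
    by_contra hn
    exact hv ⟨S, hS, hn⟩
  have h1 := hw.1 {v}
  have h2 := hw.1 (univ.erase v)
  have h3 := hv' ∅ (by simp)
  have h4 := hv' (univ.erase v) (by simp)
  rw [Finset.insert_erase (mem_univ v)] at h4
  have h5 := hw.2
  rw [← Finset.add_sum_erase univ w (mem_univ v)] at h5
  simp at h1
  simp [h0] at h3
  linarith

open Classical in
lemma aux_deg {V E : Type*} [Fintype V] [Fintype E] [DecidableEq V]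
    (F : Finset V → E → ℝ) (v : V) :
    deg F v = ∑ e : E, if v ∈ funSupp (fun S => F S e) then (1:ℝ) else 0 := by
  unfold deg
  rw [Finset.sum_boole]

open Classical in
lemma aux_core {V E : Type*} [Fintype V] [Fintype E] [DecidableEq V]
    (F : Finset V → E → ℝ) (w : E → V → ℝ) (u : V → ℝ) (φ : ℝ) (hφ : 0 ≤ φ)
    (hu : ∀ v, 0 ≤ u v)
    (hsupp : ∀ e v, v ∉ funSupp (fun S => F S e) → w e v = 0)
    (hnn : ∀ S : Finset V, (∀ a ∈ S, ∀ b, u a ≤ u b → b ∈ S) → (∀ a ∈ S, 0 < u a) →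
      ∀ e, 0 ≤ ∑ v ∈ S, w e v)
    (hcut : ∀ S : Finset V, (∀ a ∈ S, ∀ b, u a ≤ u b → b ∈ S) → (∀ a ∈ S, 0 < u a) →
      φ * volF F S ≤ ∑ e, ∑ v ∈ S, w e v) :
    φ ^ 2 * ∑ v, deg F v * u v ^ 2 ≤ 4 * ∑ e, (∑ v, w e v * u v) ^ 2 := by
  set D := ∑ v, deg F v * u v ^ 2 with hD
  set M : E → ℝ := fun e =>
    Real.sqrt (∑ v, if v ∈ funSupp (fun S => F S e) then u v ^ 2 else 0) with hM
  have hMsq : ∀ e, M e ^ 2 = ∑ v, if v ∈ funSupp (fun S => F S e) then u v ^ 2 else 0 := by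
    intro e
    apply Real.sq_sqrt
    apply Finset.sum_nonneg
    intro v _
    split_ifs
    · positivity
    · exact le_rfl
  have hM0 : ∀ e, 0 ≤ M e := fun e => Real.sqrt_nonneg _
  have hMu : ∀ e v, v ∈ funSupp (fun S => F S e) → u v ≤ M e := by
    intro e v hv
    apply Real.le_sqrt_of_sq_le
    have := Finset.single_le_sum (s := univ)
      (f := fun v => if v ∈ funSupp (fun S => F S e) then u v ^ 2 else 0)
      (fun v _ => by
        split_ifs
        · positivity
        · exact le_rfl) (mem_univ v)
    simpa [hv] using this
  have hMD : ∑ e, M e ^ 2 = D := by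
    simp_rw [hMsq]
    rw [Finset.sum_comm, hD]
    apply Finset.sum_congr rfl
    intro v _
    rw [aux_deg, Finset.sum_mul]
    apply Finset.sum_congr rfl
    intro e _
    split_ifs <;> simp
  -- step A
  have hA : φ * D ≤ ∑ e, ∑ v, w e v * u v ^ 2 := by
    have h := aux_abel' (fun v => ∑ e, w e v - φ * deg F v) (fun v => u v ^ 2)
      (fun v => by positivity) (by
        intro S hS hpos
        have h1 := hcut S (fun a ha b hab => hS a ha b (by
          have := hu a; gcongr)) (fun a ha => by
            have := hpos a ha
            exact lt_of_le_of_ne (hu a) (fun h => by rw [← h] at this; simp at this))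
        rw [Finset.sum_comm, volF, Finset.mul_sum] at h1
        rw [Finset.sum_sub_distrib]; linarith)
    have e : ∑ v, (∑ e, w e v - φ * deg F v) * u v ^ 2
        = ∑ e, ∑ v, w e v * u v ^ 2 - φ * D := by
      rw [Finset.sum_comm, hD, Finset.mul_sum, ← Finset.sum_sub_distrib]
      apply Finset.sum_congr rfl
      intro v _
      rw [sub_mul, Finset.sum_mul]; ring
    rw [e] at h
    linarith
  -- step B
  have hB : ∀ e, ∑ v, w e v * u v ^ 2 ≤ 2 * (M e * ∑ v, w e v * u v) := by
    intro e
    have h := aux_abel' (w e)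
      (fun v => 2 * M e * min (u v) (M e) - (min (u v) (M e)) ^ 2)
      (fun v => by
        have h1 : 0 ≤ min (u v) (M e) := le_min (hu v) (hM0 e)
        have h2 : min (u v) (M e) ≤ M e := min_le_right _ _
        nlinarith) (by
        intro S hS hpos
        apply hnn S _ _ e
        · intro a ha b hab
          apply hS a ha b
          have h1 : min (u a) (M e) ≤ min (u b) (M e) := min_le_min_right _ hab
          have h2 : min (u b) (M e) ≤ M e := min_le_right _ _
          nlinarith
        · intro a ha
          refine lt_of_le_of_ne (hu a) (fun h => ?_)
          have := hpos a ha
          rw [← h, min_eq_left (hM0 e)] at this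
          simp at this)
    have e1 : ∑ v, w e v * (2 * M e * min (u v) (M e) - (min (u v) (M e)) ^ 2)
        = 2 * (M e * ∑ v, w e v * u v) - ∑ v, w e v * u v ^ 2 := by
      rw [Finset.mul_sum, Finset.mul_sum, ← Finset.sum_sub_distrib]
      apply Finset.sum_congr rfl
      intro v _
      by_cases hv : v ∈ funSupp (fun S => F S e)
      · rw [min_eq_left (hMu e v hv)]; ring
      · rw [hsupp e v hv]; ring
    rw [e1] at h
    linarith
  have hC : φ * D ≤ 2 * ∑ e, M e * ∑ v, w e v * u v := by
    refine hA.trans ?_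
    rw [Finset.mul_sum]
    exact Finset.sum_le_sum (fun e _ => hB e)
  have hCS := Finset.sum_mul_sq_le_sq_mul_sq univ M (fun e => ∑ v, w e v * u v)
  rw [hMD] at hCS
  set A := ∑ e, (∑ v, w e v * u v) ^ 2 with hAdef
  have hA0 : 0 ≤ A := Finset.sum_nonneg (fun e _ => sq_nonneg _)
  have hD0 : 0 ≤ D := by rw [← hMD]; exact Finset.sum_nonneg (fun e _ => sq_nonneg _)
  rcases hD0.eq_or_lt with h | h
  · rw [← h]; linarith
  · have hsq : (φ * D) ^ 2 ≤ (2 * ∑ e, M e * ∑ v, w e v * u v) ^ 2 :=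
      pow_le_pow_left₀ (mul_nonneg hφ hD0) hC 2
    have : D * (φ ^ 2 * D) ≤ D * (4 * A) := by nlinarith
    exact le_of_mul_le_mul_left this h

lemma aux_median {V : Type*} [Fintype V] [DecidableEq V] [Nonempty V] (d y : V → ℝ)
    (hd : ∀ v, 0 ≤ d v) :
    ∃ c : ℝ, ∑ v ∈ univ.filter (fun v => c < y v), d v ≤ (∑ v, d v) / 2 ∧
      ∑ v ∈ univ.filter (fun v => y v < c), d v ≤ (∑ v, d v) / 2 := by
  have htot : 0 ≤ ∑ v, d v := Finset.sum_nonneg (fun v _ => hd v)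
  set Q := univ.filter (fun a => ∑ v ∈ univ.filter (fun v => y a < y v), d v ≤ (∑ v, d v) / 2)
    with hQ
  have hne : Q.Nonempty := by
    obtain ⟨m, _, hm⟩ := (univ : Finset V).exists_max_image y Finset.univ_nonempty
    refine ⟨m, ?_⟩
    have : univ.filter (fun v => y m < y v) = ∅ := by
      apply Finset.filter_eq_empty_iff.2
      intro v hv
      exact not_lt.2 (hm v hv)
    simp only [hQ, mem_filter, mem_univ, true_and]
    rw [this]; simp; linarith
  obtain ⟨a, haQ, ha⟩ := Q.exists_min_image y hne
  refine ⟨y a, by simpa [hQ] using haQ, ?_⟩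
  by_cases hL : (univ.filter (fun v => y v < y a)).Nonempty
  · obtain ⟨b, hb, hbm⟩ := (univ.filter (fun v => y v < y a)).exists_max_image y hL
    have hb' : y b < y a := by simpa using hb
    have hbQ : b ∉ Q := fun h => absurd (ha b h) (not_le.2 hb')
    have h1 : (∑ v, d v) / 2 < ∑ v ∈ univ.filter (fun v => y b < y v), d v := by
      by_contra hn
      exact hbQ (by simp only [hQ, mem_filter, mem_univ, true_and]; exact not_lt.1 hn)
    have h2 := Finset.sum_filter_add_sum_filter_not univ (fun v => y b < y v) d
    have h3 : univ.filter (fun v => ¬ y b < y v) = univ.filter (fun v => y v < y a) := by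
      ext v
      simp only [mem_filter, mem_univ, true_and]
      constructor
      · intro h; linarith [not_lt.1 h]
      · intro h; exact not_lt.2 (hbm v (by simpa using h))
    rw [h3] at h2
    linarith
  · rw [Finset.not_nonempty_iff_eq_empty.1 hL]; simp; linarith

lemma aux_easy {V E : Type*} [Fintype V] [DecidableEq V] [Fintype E]
    (F : Finset V → E → ℝ)
    (hUniv : ∀ e : E, F Finset.univ e = 0)
    (hRange : ∀ (e : E) (S : Finset V), F S e ∈ Set.Icc (0:ℝ) 1)
    (hDeg : ∀ v : V, 0 < deg F v) (S : Finset V) (hS : S.Nonempty) (hS' : S ≠ univ) :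
    ∃ x : V → ℝ, x ≠ 0 ∧ (∑ v, x v * Real.sqrt (deg F v)) = 0 ∧
      rayleigh F x ≤ 2 * cutF F S / min (volF F S) (volF F Sᶜ) := by
  have hSc : Sᶜ.Nonempty := by
    rw [Finset.nonempty_iff_ne_empty]
    intro h
    exact hS' (by simpa using h)
  set s := volF F S with hs
  set t := volF F Sᶜ with ht
  have hspos : 0 < s := Finset.sum_pos (fun v _ => hDeg v) hS
  have htpos : 0 < t := Finset.sum_pos (fun v _ => hDeg v) hSc
  have hst : s + t = ∑ v, deg F v := Finset.sum_add_sum_compl S _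
  set c := s / (s + t) with hc
  have hcst : c * (s + t) = s := by rw [hc]; field_simp
  set y : V → ℝ := fun v => (if v ∈ S then 1 else 0) - c with hy
  have hsq : ∀ v, Real.sqrt (deg F v) * Real.sqrt (deg F v) = deg F v :=
    fun v => Real.mul_self_sqrt (hDeg v).le
  have hsqpos : ∀ v, 0 < Real.sqrt (deg F v) := fun v => Real.sqrt_pos.2 (hDeg v)
  have hind : ∑ v, deg F v * (if v ∈ S then (1:ℝ) else 0) = s := by
    simp [hs, volF]
  have hnorm : ∑ v, (Real.sqrt (deg F v) * y v) ^ 2 = s * t / (s + t) := by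
    have : ∀ v, (Real.sqrt (deg F v) * y v) ^ 2 =
        (1 - 2 * c) * (deg F v * (if v ∈ S then (1:ℝ) else 0)) + c ^ 2 * deg F v := by
      intro v
      have h1 : (Real.sqrt (deg F v) * y v) ^ 2 = deg F v * y v ^ 2 := by
        rw [mul_pow, sq (Real.sqrt _), hsq]
      rw [h1]
      simp only [hy]
      split_ifs <;> ring
    simp_rw [this]
    rw [Finset.sum_add_distrib, ← Finset.mul_sum, ← Finset.mul_sum, hind, ← hst, hc]
    field_simp
    ring
  have hnpos : 0 < s * t / (s + t) := by positivity
  refine ⟨fun v => Real.sqrt (deg F v) * y v, ?_, ?_, ?_⟩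
  · intro h
    have h' : ∀ v, Real.sqrt (deg F v) * y v = 0 := fun v => congrFun h v
    simp_rw [h'] at hnorm
    simp at hnorm
    rw [← hnorm] at hnpos
    exact lt_irrefl _ hnpos
  · have : ∀ v, Real.sqrt (deg F v) * y v * Real.sqrt (deg F v)
        = deg F v * (if v ∈ S then (1:ℝ) else 0) - c * deg F v := by
      intro v
      have h1 : Real.sqrt (deg F v) * y v * Real.sqrt (deg F v) = deg F v * y v := by
        rw [mul_right_comm, hsq]
      rw [h1]; simp only [hy]; ring
    simp_rw [this]
    rw [Finset.sum_sub_distrib, ← Finset.mul_sum, hind, ← hst, hcst, sub_self]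
  · unfold rayleigh
    rw [hnorm]
    have hyx : (fun v => Real.sqrt (deg F v) * y v / Real.sqrt (deg F v)) = y := by
      ext v
      have := (hsqpos v).ne'
      field_simp
    rw [hyx]
    have hL : ∀ e, lovasz (fun S => F S e) y ^ 2 ≤ F S e := by
      intro e
      have hub : ∀ r ∈ (fun w : V → ℝ => ∑ v, w v * y v) '' basePolytope (fun S => F S e),
          r ≤ F S e := by
        rintro _ ⟨w, hw, rfl⟩
        have h1 : ∑ v, w v * y v = ∑ v ∈ S, w v - c * ∑ v, w v := by
          simp only [hy, mul_sub]
          rw [Finset.sum_sub_distrib, Finset.mul_sum]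
          simp [mul_comm]
        have h2 := hw.1 S
        have h3 := hw.2
        simp only at h2 h3 ⊢
        rw [h1, h3, hUniv e]; linarith
      have h0 : (0:ℝ) ∈ (fun w : V → ℝ => ∑ v, w v * y v) '' basePolytope (fun S => F S e) := by
        refine ⟨0, ⟨fun T => ?_, ?_⟩, by simp⟩
        · simpa using (hRange e T).1
        · simpa using (hUniv e).symm
      have h1 : 0 ≤ lovasz (fun S => F S e) y := le_csSup ⟨_, hub⟩ h0
      have h2 : lovasz (fun S => F S e) y ≤ F S e := csSup_le ⟨0, h0⟩ hub
      have h3 := (hRange e S).2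
      nlinarith
    have hsum : ∑ e, lovasz (fun S => F S e) y ^ 2 ≤ cutF F S :=
      Finset.sum_le_sum (fun e _ => hL e)
    have hcut0 : 0 ≤ cutF F S := Finset.sum_nonneg (fun e _ => (hRange e S).1)
    have hm : 0 < min s t := lt_min hspos htpos
    have hmm : min s t * (s + t) ≤ 2 * (s * t) := by
      rcases le_total s t with h | h
      · rw [min_eq_left h]; nlinarith
      · rw [min_eq_right h]; nlinarith
    calc _ ≤ cutF F S / (s * t / (s + t)) := by gcongr
      _ ≤ _ := by
        rw [div_le_div_iff₀ hnpos hm]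
        have : min s t ≤ 2 * (s * t / (s + t)) := by
          rw [← mul_div_assoc, le_div_iff₀ (by positivity)]; exact hmm
        nlinarith

lemma aux_ray_nonneg {V E : Type*} [Fintype V] [DecidableEq V] [Fintype E]
    (F : Finset V → E → ℝ) (x : V → ℝ) : 0 ≤ rayleigh F x :=
  div_nonneg (Finset.sum_nonneg fun _ _ => sq_nonneg _) (Finset.sum_nonneg fun _ _ => sq_nonneg _)

lemma aux_cond_nonneg {V E : Type*} [Fintype V] [DecidableEq V] [Fintype E]
    (F : Finset V → E → ℝ)
    (hRange : ∀ (e : E) (S : Finset V), F S e ∈ Set.Icc (0:ℝ) 1)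
    (hDeg : ∀ v : V, 0 < deg F v) (S : Finset V) : 0 ≤ condOf F S := by
  have hc : ∀ S, 0 ≤ cutF F S := fun S => Finset.sum_nonneg (fun e _ => (hRange e S).1)
  have hv : ∀ S, 0 ≤ volF F S := fun S => Finset.sum_nonneg (fun v _ => (hDeg v).le)
  exact div_nonneg (le_min (hc _) (hc _)) (le_min (hv _) (hv _))

lemma aux_cond {V E : Type*} [Fintype V] [DecidableEq V] [Nonempty V] [Fintype E]
    (F : Finset V → E → ℝ)
    (hRange : ∀ (e : E) (S : Finset V), F S e ∈ Set.Icc (0:ℝ) 1)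
    (hDeg : ∀ v : V, 0 < deg F v) (S : Finset V)
    (hvol : volF F S ≤ (∑ v, deg F v) / 2) :
    conduct F * volF F S ≤ cutF F S ∧ conduct F * volF F S ≤ cutF F Sᶜ := by
  have hc : ∀ S, 0 ≤ cutF F S := fun S => Finset.sum_nonneg (fun e _ => (hRange e S).1)
  have htot : 0 < ∑ v, deg F v := Finset.sum_pos (fun v _ => hDeg v) Finset.univ_nonempty
  rcases S.eq_empty_or_nonempty with h | h
  · have : volF F S = 0 := by rw [h]; simp [volF]
    rw [this, mul_zero]
    exact ⟨hc _, hc _⟩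
  · have hne : S ≠ univ := by
      rintro rfl
      unfold volF at hvol
      linarith
    have h1 : conduct F ≤ condOf F S :=
      csInf_le ⟨0, by rintro _ ⟨T, _, _, rfl⟩; exact aux_cond_nonneg F hRange hDeg T⟩
        ⟨S, h, hne, rfl⟩
    have hst : volF F S + volF F Sᶜ = ∑ v, deg F v := Finset.sum_add_sum_compl S _
    have hpos : 0 < volF F S := Finset.sum_pos (fun v _ => hDeg v) h
    unfold condOf at h1
    rw [min_eq_left (a := volF F S) (by linarith), le_div_iff₀ hpos] at h1
    exact ⟨h1.trans (min_le_left _ _), h1.trans (min_le_right _ _)⟩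

lemma aux_hard {V E : Type*} [Fintype V] [DecidableEq V] [Nonempty V] [Fintype E]
    (F : Finset V → E → ℝ)
    (hsub : ∀ e : E, Submodular (fun S => F S e))
    (hEmpty : ∀ e : E, F ∅ e = 0)
    (hUniv : ∀ e : E, F Finset.univ e = 0)
    (hRange : ∀ (e : E) (S : Finset V), F S e ∈ Set.Icc (0:ℝ) 1)
    (hDeg : ∀ v : V, 0 < deg F v) (hφ : 0 ≤ conduct F)
    (x : V → ℝ) (hx : x ≠ 0) (hxo : (∑ v, x v * Real.sqrt (deg F v)) = 0) :
    (conduct F) ^ 2 / 4 ≤ rayleigh F x := by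
  set φ := conduct F with hφd
  have hsq : ∀ v, Real.sqrt (deg F v) * Real.sqrt (deg F v) = deg F v :=
    fun v => Real.mul_self_sqrt (hDeg v).le
  have hsqpos : ∀ v, 0 < Real.sqrt (deg F v) := fun v => Real.sqrt_pos.2 (hDeg v)
  set y : V → ℝ := fun v => x v / Real.sqrt (deg F v) with hy
  have hxy : ∀ v, x v = y v * Real.sqrt (deg F v) := by
    intro v
    have := (hsqpos v).ne'
    simp only [hy]; field_simp
  have hyo : ∑ v, deg F v * y v = 0 := by
    rw [← hxo]
    apply Finset.sum_congr rfl
    intro v _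
    rw [hxy v, mul_assoc, hsq, mul_comm]
  have hxn : ∑ v, x v ^ 2 = ∑ v, deg F v * y v ^ 2 := by
    apply Finset.sum_congr rfl
    intro v _
    rw [hxy v, mul_pow, sq (Real.sqrt _), hsq, mul_comm]
  have hxpos : 0 < ∑ v, x v ^ 2 := by
    obtain ⟨v, hv⟩ := Function.ne_iff.1 hx
    have hv' : x v ≠ 0 := hv
    exact Finset.sum_pos' (fun v _ => sq_nonneg _) ⟨v, mem_univ v, by positivity⟩
  obtain ⟨c, hc1, hc2⟩ := aux_median (deg F) y (fun v => (hDeg v).le)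
  choose w hwB hwt using fun e => aux_greedy (fun S => F S e) (hsub e) (hEmpty e) y
  have hL : ∀ e, lovasz (fun S => F S e) y = ∑ v, w e v * y v :=
    fun e => (aux_lovasz _ y (w e) (hwB e) (hwt e)).csSup_eq
  have hw0 : ∀ e, ∑ v, w e v = 0 := fun e => by
    have := (hwB e).2
    simp only [hUniv e] at this
    exact this
  have hsupp : ∀ e v, v ∉ funSupp (fun S => F S e) → w e v = 0 :=
    fun e v hv => aux_supp _ (hEmpty e) (w e) (hwB e) v hv
  have hdeg0 : ∀ v, 0 ≤ deg F v := fun v => (hDeg v).le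
  -- positive part
  set p : V → ℝ := fun v => max (y v - c) 0 with hp
  set q : V → ℝ := fun v => max (c - y v) 0 with hq
  have hpS : ∀ S : Finset V, (∀ a ∈ S, ∀ b, p a ≤ p b → b ∈ S) →
      ∀ e, ∑ v ∈ S, w e v = F S e := by
    intro S hS e
    apply hwt e S
    intro a ha b hab
    exact hS a ha b (max_le_max_right _ (by linarith))
  have hqS : ∀ S : Finset V, (∀ a ∈ S, ∀ b, q a ≤ q b → b ∈ S) →
      ∀ e, ∑ v ∈ S, (-w e v) = F Sᶜ e := by
    intro S hS e
    have h1 := hwt e Sᶜ (by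
      intro a ha b hab
      rw [Finset.mem_compl] at ha ⊢
      intro hb
      exact ha (hS b hb a (max_le_max_right _ (by linarith))))
    have h2 := Finset.sum_add_sum_compl S (w e)
    rw [hw0 e, h1] at h2
    rw [Finset.sum_neg_distrib]; linarith
  have hpv : ∀ S : Finset V, (∀ a ∈ S, 0 < p a) → volF F S ≤ (∑ v, deg F v) / 2 := by
    intro S hS
    refine le_trans ?_ hc1
    apply Finset.sum_le_sum_of_subset_of_nonneg
    · intro a ha
      have := hS a ha
      simp [hp] at this
      simpa using this
    · intro v _ _; exact hdeg0 v
  have hqv : ∀ S : Finset V, (∀ a ∈ S, 0 < q a) → volF F S ≤ (∑ v, deg F v) / 2 := by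
    intro S hS
    refine le_trans ?_ hc2
    apply Finset.sum_le_sum_of_subset_of_nonneg
    · intro a ha
      have := hS a ha
      simp [hq] at this
      simpa using this
    · intro v _ _; exact hdeg0 v
  have hP := aux_core F w p φ hφ (fun v => le_max_right _ _) hsupp
    (fun S hS _ e => by rw [hpS S hS e]; exact (hRange e S).1)
    (fun S hS hpos => by
      simp_rw [hpS S hS]
      exact (aux_cond F hRange hDeg S (hpv S hpos)).1)
  have hQ := aux_core F (fun e v => - w e v) q φ hφ (fun v => le_max_right _ _)
    (fun e v hv => by simp [hsupp e v hv])
    (fun S hS _ e => by rw [hqS S hS e]; exact (hRange e _).1)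
    (fun S hS hpos => by
      simp_rw [hqS S hS]
      exact (aux_cond F hRange hDeg S (hqv S hpos)).2)
  have hpn : ∀ e, 0 ≤ ∑ v, w e v * p v := fun e =>
    aux_abel' (w e) p (fun v => le_max_right _ _)
      (fun S hS _ => by rw [hpS S hS e]; exact (hRange e S).1)
  have hqn : ∀ e, 0 ≤ ∑ v, (-w e v) * q v := fun e =>
    aux_abel' (fun v => - w e v) q (fun v => le_max_right _ _)
      (fun S hS _ => by rw [hqS S hS e]; exact (hRange e _).1)
  have hpq : ∀ v, p v - q v = y v - c := by
    intro v
    simp only [hp, hq]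
    rcases le_total (y v) c with h | h
    · rw [max_eq_right (by linarith), max_eq_left (by linarith)]; ring
    · rw [max_eq_left (by linarith), max_eq_right (by linarith)]; ring
  have hpq2 : ∀ v, p v ^ 2 + q v ^ 2 = (y v - c) ^ 2 := by
    intro v
    simp only [hp, hq]
    rcases le_total (y v) c with h | h
    · rw [max_eq_right (by linarith), max_eq_left (by linarith)]; ring
    · rw [max_eq_left (by linarith), max_eq_right (by linarith)]; ring
  have hsplit : ∀ e, ∑ v, w e v * y v = ∑ v, w e v * p v + ∑ v, (-w e v) * q v := by
    intro e
    have h1 : ∑ v, w e v * y v = ∑ v, w e v * y v - (∑ v, w e v) * c := by rw [hw0 e]; ring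
    rw [h1, Finset.sum_mul, ← Finset.sum_sub_distrib, ← Finset.sum_add_distrib]
    apply Finset.sum_congr rfl
    intro v _
    linear_combination (- w e v) * hpq v
  have hfin : ∑ e, (∑ v, w e v * p v) ^ 2 + ∑ e, (∑ v, (-w e v) * q v) ^ 2
      ≤ ∑ e, lovasz (fun S => F S e) y ^ 2 := by
    rw [← Finset.sum_add_distrib]
    apply Finset.sum_le_sum
    intro e _
    rw [hL e, hsplit e]
    nlinarith [mul_nonneg (hpn e) (hqn e)]
  have hDsum : ∑ v, deg F v * y v ^ 2 ≤ ∑ v, deg F v * p v ^ 2 + ∑ v, deg F v * q v ^ 2 := by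
    have : ∑ v, deg F v * p v ^ 2 + ∑ v, deg F v * q v ^ 2 =
        ∑ v, deg F v * y v ^ 2 - 2 * c * ∑ v, deg F v * y v + c ^ 2 * ∑ v, deg F v := by
      rw [Finset.mul_sum, Finset.mul_sum, ← Finset.sum_add_distrib, ← Finset.sum_sub_distrib,
        ← Finset.sum_add_distrib]
      apply Finset.sum_congr rfl
      intro v _
      linear_combination (deg F v) * hpq2 v
    rw [this, hyo]
    have : 0 ≤ c ^ 2 * ∑ v, deg F v :=
      mul_nonneg (sq_nonneg _) (Finset.sum_nonneg fun v _ => hdeg0 v)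
    linarith
  unfold rayleigh
  rw [le_div_iff₀ hxpos, hxn]
  have := mul_le_mul_of_nonneg_left hDsum (sq_nonneg φ)
  linarith

end Helpers

/-- **Cheeger inequality for submodular transformations** (Theorem 1.1).
If `F : 2^V → ℝ^E` is a submodular transformation on a finite set `V` with `|V| ≥ 2`,
`F(∅) = F(V) = 0`, `F_e(S) ∈ [0,1]` for all `e, S`, and all degrees are positive, then
`λ_F / 2 ≤ φ_F ≤ 2 √λ_F`. -/
theorem cheeger_inequality
    {V E : Type*} [Fintype V] [DecidableEq V] [Fintype E]
    (F : Finset V → E → ℝ)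
    (hcard : 2 ≤ Fintype.card V)
    (hsub : ∀ e : E, Submodular (fun S => F S e))
    (hEmpty : ∀ e : E, F ∅ e = 0)
    (hUniv : ∀ e : E, F Finset.univ e = 0)
    (hRange : ∀ (e : E) (S : Finset V), F S e ∈ Set.Icc (0:ℝ) 1)
    (hDeg : ∀ v : V, 0 < deg F v) :
    lambdaF F / 2 ≤ conduct F ∧ conduct F ≤ 2 * Real.sqrt (lambdaF F) := by
  have hV : Nonempty V := Fintype.card_pos_iff.1 (by omega)
  have hcut0 : ∀ S, 0 ≤ cutF F S := fun S => Finset.sum_nonneg (fun e _ => (hRange e S).1)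
  have hlamBdd : BddBelow {r | ∃ x : V → ℝ, x ≠ 0 ∧
      (∑ v, x v * Real.sqrt (deg F v)) = 0 ∧ r = rayleigh F x} :=
    ⟨0, by rintro _ ⟨x, _, _, rfl⟩; exact aux_ray_nonneg F x⟩
  have hlam : ∀ S : Finset V, S.Nonempty → S ≠ univ →
      lambdaF F ≤ 2 * cutF F S / min (volF F S) (volF F Sᶜ) := by
    intro S hS hS'
    obtain ⟨x, h1, h2, h3⟩ := aux_easy F hUniv hRange hDeg S hS hS'
    exact (csInf_le hlamBdd ⟨x, h1, h2, rfl⟩).trans h3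
  obtain ⟨v0⟩ := hV
  have hS0 : ({v0} : Finset V) ≠ univ := by
    intro h
    have := congrArg Finset.card h
    rw [Finset.card_singleton, Finset.card_univ] at this
    omega
  have hφ : 0 ≤ conduct F := by
    apply Real.sInf_nonneg
    rintro _ ⟨T, _, _, rfl⟩
    exact aux_cond_nonneg F hRange hDeg T
  constructor
  · apply le_csInf
    · exact ⟨_, {v0}, Finset.singleton_nonempty _, hS0, rfl⟩
    · rintro _ ⟨S, hS, hS', rfl⟩
      have hSc : Sᶜ.Nonempty := by
        rw [Finset.nonempty_iff_ne_empty]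
        intro h
        exact hS' (by simpa using h)
      have hSc' : Sᶜ ≠ univ := by
        intro h
        rw [Finset.compl_eq_univ_iff] at h
        exact hS.ne_empty h
      have h1 := hlam S hS hS'
      have h2 := hlam Sᶜ hSc hSc'
      rw [compl_compl, min_comm] at h2
      unfold condOf
      rw [mul_div_assoc] at h1 h2
      rcases min_choice (cutF F S) (cutF F Sᶜ) with h | h <;> rw [h] <;> linarith
  · haveI : Nonempty V := ⟨v0⟩
    have h : conduct F ^ 2 / 4 ≤ lambdaF F := by
      apply le_csInf
      · obtain ⟨x, h1, h2, _⟩ :=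
          aux_easy F hUniv hRange hDeg {v0} (Finset.singleton_nonempty _) hS0
        exact ⟨_, x, h1, h2, rfl⟩
      · rintro _ ⟨x, hx, hxo, rfl⟩
        exact aux_hard F hsub hEmpty hUniv hRange hDeg hφ x hx hxo
    have h2 : conduct F / 2 ≤ Real.sqrt (lambdaF F) := by
      apply Real.le_sqrt_of_sq_le
      linarith [div_pow (conduct F) 2 2]
    linarith
end

section
/- Let F : 2^V → ℝ^E be a submodular transformation on a finite set V with |V| = n ≥ 2 such that F(∅) = 0, F(V) = 0, and d_F(v) > 0 for all v ∈ V. Then the normalized Laplacian ℒ_F has a non-trivial eigenpair: there exist γ ≥ 0 and a nonzero vector z ∈ ℝ^V with ⟨z, D_F^{1/2} 1⟩ = 0 such that γ z ∈ ℒ_F(z). Furthermore, every γ ∈ ℝ and nonzero z ∈ ℝ^V with ⟨z, D_F^{1/2} 1⟩ = 0 and γ z ∈ ℒ_F(z) satisfy γ = ℛ_F(z). -/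
open Finset

variable {V E : Type*}

/-- The normalized Laplacian `ℒ_F(x) = D_F^{-1/2} L_F(D_F^{-1/2} x)`. -/
noncomputable def normLaplacian {V E : Type*} [Fintype V] [DecidableEq V] [Fintype E]
    (F : Finset V → E → ℝ) (x : V → ℝ) : Set (V → ℝ) :=
  {y | ∃ z ∈ laplacian F (fun v => x v / Real.sqrt (deg F v)),
    y = fun v => z v / Real.sqrt (deg F v)}

lemma base_nonempty_aux [DecidableEq V] (G : Finset V → ℝ) (hG : Submodular G) (h0 : G ∅ = 0)
    (A : Finset V) : ∃ w : V → ℝ, (∀ S ⊆ A, ∑ v ∈ S, w v ≤ G S) ∧ ∑ v ∈ A, w v = G A := by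
  induction A using Finset.induction_on with
  | empty =>
    refine ⟨0, ?_, by simp [h0]⟩
    intro S hS
    rw [Finset.subset_empty] at hS
    subst hS
    simp [h0]
  | insert a A ha ih =>
    obtain ⟨w, hw, hwA⟩ := ih
    have key : ∀ S : Finset V, a ∉ S →
        ∑ v ∈ S, Function.update w a (G (insert a A) - G A) v = ∑ v ∈ S, w v := by
      intro S hS
      refine Finset.sum_congr rfl fun v hv => ?_
      rw [Function.update_of_ne]
      rintro rfl
      exact hS hv
    refine ⟨Function.update w a (G (insert a A) - G A), ?_, ?_⟩
    · intro S hS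
      by_cases haS : a ∈ S
      · have h1 : ∑ v ∈ S.erase a, w v ≤ G (S.erase a) := by
          apply hw
          intro v hv
          rw [Finset.mem_erase] at hv
          have := hS hv.2
          rw [Finset.mem_insert] at this
          tauto
        rw [← Finset.add_sum_erase _ _ haS, key _ (Finset.notMem_erase a S),
          Function.update_self]
        have h2 := hG S A
        have h3 : S ∪ A = insert a A := by
          ext v
          have := @hS v
          simp only [Finset.mem_union, Finset.mem_insert] at *
          constructor
          · tauto
          · rintro (rfl | h)
            · exact Or.inl haS
            · exact Or.inr h
        have h4 : S ∩ A = S.erase a := by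
          ext v
          have := @hS v
          simp only [Finset.mem_inter, Finset.mem_insert, Finset.mem_erase] at *
          constructor
          · rintro ⟨h, h'⟩
            refine ⟨?_, h⟩
            rintro rfl
            exact ha h'
          · tauto
        rw [h3, h4] at h2
        linarith
      · rw [key S haS]
        apply hw
        intro v hv
        have := hS hv
        rw [Finset.mem_insert] at this
        rcases this with rfl | h
        · exact absurd hv haS
        · exact h
    · rw [Finset.sum_insert ha, key A ha, Function.update_self, hwA]
      ring

lemma base_nonempty [Fintype V] [DecidableEq V] (G : Finset V → ℝ) (hG : Submodular G)
    (h0 : G ∅ = 0) : (basePolytope G).Nonempty := by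
  obtain ⟨w, h1, h2⟩ := base_nonempty_aux G hG h0 Finset.univ
  exact ⟨w, fun S => h1 S (Finset.subset_univ S), h2⟩

lemma base_convex [Fintype V] (G : Finset V → ℝ) : Convex ℝ (basePolytope G) := by
  rintro x ⟨hx, hx'⟩ y ⟨hy, hy'⟩ a b ha hb hab
  constructor
  · intro S
    simp only [Pi.add_apply, Pi.smul_apply, smul_eq_mul, Finset.sum_add_distrib,
      ← Finset.mul_sum]
    have h1 := mul_le_mul_of_nonneg_left (hx S) ha
    have h2 := mul_le_mul_of_nonneg_left (hy S) hb
    have : a * G S + b * G S = G S := by rw [← add_mul, hab, one_mul]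
    linarith
  · simp only [Pi.add_apply, Pi.smul_apply, smul_eq_mul, Finset.sum_add_distrib,
      ← Finset.mul_sum]
    rw [hx', hy', ← add_mul, hab, one_mul]

lemma base_compact [Fintype V] [DecidableEq V] (G : Finset V → ℝ) :
    IsCompact (basePolytope G) := by
  have hcl : IsClosed (basePolytope G) := by
    have : basePolytope G = (⋂ S : Finset V, {w | ∑ v ∈ S, w v ≤ G S}) ∩
        {w | ∑ v, w v = G Finset.univ} := by
      ext w
      simp [basePolytope]
    rw [this]
    refine IsClosed.inter (isClosed_iInter fun S => ?_) ?_
    · exact isClosed_le (by fun_prop) continuous_const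
    · exact isClosed_eq (by fun_prop) continuous_const
  refine IsCompact.of_isClosed_subset (isCompact_univ_pi
    (fun v : V => isCompact_Icc (a := G Finset.univ - G (Finset.univ.erase v)) (b := G {v})))
    hcl ?_
  rintro w ⟨h1, h2⟩ v -
  have h3 := h1 {v}
  have h4 := h1 (Finset.univ.erase v)
  rw [Finset.sum_singleton] at h3
  rw [← Finset.add_sum_erase _ _ (Finset.mem_univ v)] at h2
  exact ⟨by linarith, h3⟩

lemma core_eigen [Fintype V] [DecidableEq V] [Fintype E] (B : E → Set (V → ℝ))
    (hc : ∀ e, IsCompact (B e))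
    (hconv : ∀ e, Convex ℝ (B e)) (hne : ∀ e, (B e).Nonempty) (u : V → ℝ) (hu : 0 < u ⬝ᵥ u)
    (hBu : ∀ e, ∀ w ∈ B e, w ⬝ᵥ u = 0) (y0 : V → ℝ) (hy0 : y0 ≠ 0) (hy0u : y0 ⬝ᵥ u = 0) :
    ∃ (γ : ℝ) (z : V → ℝ), 0 ≤ γ ∧ z ≠ 0 ∧ z ⬝ᵥ u = 0 ∧ ∃ w : E → V → ℝ,
      (∀ e, w e ∈ B e ∧ ∀ w' ∈ B e, w' ⬝ᵥ z ≤ w e ⬝ᵥ z) ∧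
      γ • z = ∑ e, (w e ⬝ᵥ z) • w e := by
  have hpos : ∀ y : V → ℝ, y ≠ 0 → 0 < y ⬝ᵥ y := by
    intro y hy
    have h1 : 0 ≤ y ⬝ᵥ y := Finset.sum_nonneg fun i _ => mul_self_nonneg _
    exact lt_of_le_of_ne h1 fun h => hy (dotProduct_self_eq_zero.1 h.symm)
  have hdc : Continuous (fun p : (V → ℝ) × (V → ℝ) => p.1 ⬝ᵥ p.2) := by
    unfold dotProduct
    fun_prop
  obtain ⟨h, hh⟩ : ∃ h : E → (V → ℝ) → ℝ,
      h = fun e x => sSup ((fun w => w ⬝ᵥ x) '' B e) := ⟨_, rfl⟩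
  have hcont : ∀ e, Continuous (h e) := by
    intro e
    rw [hh]
    refine IsCompact.continuous_sSup (f := fun (x w : V → ℝ) => w ⬝ᵥ x) (hc e) ?_
    exact hdc.comp continuous_swap
  have hbdd : ∀ e x, BddAbove ((fun w => w ⬝ᵥ x) '' B e) := by
    intro e x
    refine ((hc e).image ?_).bddAbove
    unfold dotProduct; fun_prop
  have hle : ∀ e x, ∀ w ∈ B e, w ⬝ᵥ x ≤ h e x := by
    intro e x w hw
    rw [hh]
    exact le_csSup (hbdd e x) ⟨w, hw, rfl⟩
  have hex : ∀ e x, ∃ w ∈ B e, w ⬝ᵥ x = h e x := by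
    intro e x
    have hcx : Continuous (fun w : V → ℝ => w ⬝ᵥ x) := by unfold dotProduct; fun_prop
    have := ((hc e).image hcx).sSup_mem ((hne e).image _)
    rw [hh]
    exact this
  -- homogeneity
  have hhom : ∀ e (c : ℝ) x, 0 ≤ c → h e (c • x) = c * h e x := by
    intro e c x hc0
    apply le_antisymm
    · obtain ⟨w, hw, hwe⟩ := hex e (c • x)
      rw [← hwe, dotProduct_smul, smul_eq_mul]
      exact mul_le_mul_of_nonneg_left (hle e x w hw) hc0
    · obtain ⟨w, hw, hwe⟩ := hex e x
      rw [← hwe, ← smul_eq_mul, ← dotProduct_smul]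
      exact hle e _ w hw
  -- minimizer
  obtain ⟨Q, hQ⟩ : ∃ Q : (V → ℝ) → ℝ, Q = fun x => ∑ e, h e x ^ 2 := ⟨_, rfl⟩
  have hQc : Continuous Q := by
    rw [hQ]
    exact continuous_finsetSum _ fun e _ => (hcont e).pow 2
  have hQhom : ∀ (c : ℝ) x, 0 ≤ c → Q (c • x) = c ^ 2 * Q x := by
    intro c x hc0
    rw [hQ]
    simp only [hhom _ c x hc0, mul_pow, Finset.mul_sum]
  have hQ0 : ∀ x, 0 ≤ Q x := by
    intro x
    rw [hQ]
    exact Finset.sum_nonneg fun e _ => sq_nonneg _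
  let K : Set (V → ℝ) := {x | x ⬝ᵥ x = 1 ∧ x ⬝ᵥ u = 0}
  have hscale : ∀ y : V → ℝ, y ≠ 0 → y ⬝ᵥ u = 0 →
      (Real.sqrt (y ⬝ᵥ y))⁻¹ • y ∈ K := by
    intro y hy hyu
    have hp := hpos y hy
    constructor
    · rw [smul_dotProduct, dotProduct_smul, smul_eq_mul, smul_eq_mul, ← mul_assoc, ← mul_inv,
        Real.mul_self_sqrt hp.le, inv_mul_cancel₀ hp.ne']
    · rw [smul_dotProduct, hyu, smul_zero]
  have hKc : IsCompact K := by
    have hcl : IsClosed K := by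
      refine IsClosed.inter (isClosed_eq (by unfold dotProduct; fun_prop) continuous_const)
        (isClosed_eq (by unfold dotProduct; fun_prop) continuous_const)
    refine IsCompact.of_isClosed_subset (isCompact_univ_pi
      (fun v : V => isCompact_Icc (a := (-1 : ℝ)) (b := 1))) hcl ?_
    rintro x ⟨hx, -⟩ v -
    have : x v * x v ≤ x ⬝ᵥ x :=
      Finset.single_le_sum (f := fun i => x i * x i) (fun i _ => mul_self_nonneg _)
        (Finset.mem_univ v)
    rw [hx] at this
    constructor <;> nlinarith
  obtain ⟨z, hzK, hzmin⟩ := hKc.exists_isMinOn ⟨_, hscale y0 hy0 hy0u⟩ hQc.continuousOn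
  obtain ⟨hz1, hzu⟩ := hzK
  have hzne : z ≠ 0 := by
    rintro rfl
    simp at hz1
  have hmin : ∀ y : V → ℝ, y ⬝ᵥ u = 0 → Q z * (y ⬝ᵥ y) ≤ Q y := by
    intro y hyu
    by_cases hy : y = 0
    · subst hy
      simpa using hQ0 0
    · have h1 : Q z ≤ _ := hzmin (hscale y hy hyu)
      have hp := hpos y hy
      rw [hQhom _ _ (by positivity), inv_pow, Real.sq_sqrt hp.le] at h1
      calc Q z * (y ⬝ᵥ y) ≤ ((y ⬝ᵥ y)⁻¹ * Q y) * (y ⬝ᵥ y) :=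
            mul_le_mul_of_nonneg_right h1 hp.le
        _ = Q y := by field_simp
  let S : Set (E → V → ℝ) := Set.pi Set.univ fun e => {w | w ∈ B e ∧ w ⬝ᵥ z = h e z}
  have hcz : Continuous (fun w : V → ℝ => w ⬝ᵥ z) := by unfold dotProduct; fun_prop
  have hSc : IsCompact S :=
    isCompact_univ_pi fun e => (hc e).inter_right (isClosed_eq hcz continuous_const)
  have hSconv : Convex ℝ S := by
    apply convex_pi
    rintro e -
    rintro x ⟨hx, hx'⟩ y ⟨hy, hy'⟩ a b ha hb hab
    refine ⟨hconv e hx hy ha hb hab, ?_⟩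
    rw [add_dotProduct, smul_dotProduct, smul_dotProduct, hx', hy', smul_eq_mul, smul_eq_mul,
      ← add_mul, hab, one_mul]
  let T : (E → V → ℝ) →ₗ[ℝ] (V → ℝ) :=
    ∑ e, (h e z) • (LinearMap.proj e : (E → V → ℝ) →ₗ[ℝ] (V → ℝ))
  have hT : ∀ w, T w = ∑ e, h e z • w e := by
    intro w
    simp [T]
  suffices hmem : Q z • z ∈ T '' S by
    obtain ⟨w, hw, hwz⟩ := hmem
    refine ⟨Q z, z, hQ0 z, hzne, hzu, w, fun e => ⟨(hw e trivial).1, fun w' hw' => ?_⟩, ?_⟩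
    · rw [(hw e trivial).2]
      exact hle e z w' hw'
    · rw [← hwz, hT]
      exact Finset.sum_congr rfl fun e _ => by rw [(hw e trivial).2]
  by_contra hnot
  obtain ⟨φ, c, hφ1, hφ2⟩ := geometric_hahn_banach_closed_point (hSconv.linear_image T)
    (hSc.image T.continuous_of_finiteDimensional).isClosed hnot
  let d0 : V → ℝ := fun v => φ (Pi.single v 1)
  have hφ : ∀ x, φ x = x ⬝ᵥ d0 := by
    intro x
    conv_lhs => rw [← Finset.univ_sum_single x]
    rw [map_sum]
    refine Finset.sum_congr rfl fun v _ => ?_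
    have : Pi.single v (x v) = x v • (Pi.single v (1 : ℝ) : V → ℝ) := by
      rw [← Pi.single_smul]; simp
    rw [this, map_smul, smul_eq_mul]
  let d : V → ℝ := d0 - ((d0 ⬝ᵥ u) / (u ⬝ᵥ u)) • u
  have hdu : d ⬝ᵥ u = 0 := by
    simp only [d]
    rw [sub_dotProduct, smul_dotProduct, smul_eq_mul]
    field_simp
    ring
  have hdd : ∀ x : V → ℝ, x ⬝ᵥ u = 0 → x ⬝ᵥ d = x ⬝ᵥ d0 := by
    intro x hx
    simp only [d]
    rw [dotProduct_sub, dotProduct_smul, hx]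
    simp
  -- sequence
  let t : ℕ → ℝ := fun n => 1 / ((n : ℝ) + 1)
  have htpos : ∀ n, 0 < t n := fun n => by positivity
  have ht0 : Filter.Tendsto t Filter.atTop (nhds 0) := tendsto_one_div_add_atTop_nhds_zero_nat
  choose W hWB hW using hex
  obtain ⟨w, hwB, σ, hσ, hwlim⟩ := (isCompact_univ_pi hc).tendsto_subseq
    (x := fun n => fun e => W e (z + t n • d)) (fun n e _ => hWB e _)
  have hs0 : Filter.Tendsto (fun n => t (σ n)) Filter.atTop (nhds 0) :=
    ht0.comp hσ.tendsto_atTop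
  have hxlim : Filter.Tendsto (fun n => z + t (σ n) • d) Filter.atTop (nhds z) := by
    have := (hs0.smul_const d).const_add z
    simpa using this
  have hwlim' : ∀ e, Filter.Tendsto (fun n => W e (z + t (σ n) • d)) Filter.atTop
      (nhds (w e)) := fun e => (tendsto_pi_nhds.1 hwlim) e
  have hhlim : ∀ e, Filter.Tendsto (fun n => h e (z + t (σ n) • d)) Filter.atTop
      (nhds (h e z)) := fun e => ((hcont e).tendsto z).comp hxlim
  have hwz : ∀ e, w e ⬝ᵥ z = h e z := by
    intro e
    have h1 : Filter.Tendsto (fun n => W e (z + t (σ n) • d) ⬝ᵥ (z + t (σ n) • d)) Filter.atTop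
        (nhds (w e ⬝ᵥ z)) := (hdc.tendsto (w e, z)).comp ((hwlim' e).prodMk_nhds hxlim)
    simp only [hW] at h1
    exact tendsto_nhds_unique h1 (hhlim e)
  have hwS : w ∈ S := fun e _ => ⟨hwB e trivial, hwz e⟩
  have hquot : ∀ e, Filter.Tendsto (fun n => (h e (z + t (σ n) • d) - h e z) / t (σ n))
      Filter.atTop (nhds (w e ⬝ᵥ d)) := by
    intro e
    have hup : Filter.Tendsto (fun n => W e (z + t (σ n) • d) ⬝ᵥ d) Filter.atTop
        (nhds (w e ⬝ᵥ d)) := (hdc.tendsto (w e, d)).comp ((hwlim' e).prodMk_nhds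
          tendsto_const_nhds)
    refine tendsto_of_tendsto_of_tendsto_of_le_of_le tendsto_const_nhds hup ?_ ?_
    · intro n
      have h1 := hle e (z + t (σ n) • d) (w e) (hwB e trivial)
      rw [dotProduct_add, dotProduct_smul, hwz, smul_eq_mul] at h1
      show _ ≤ _ / _
      rw [le_div_iff₀ (htpos _)]
      linarith
    · intro n
      have h1 := hW e (z + t (σ n) • d)
      have h2 := hle e z _ (hWB e (z + t (σ n) • d))
      rw [dotProduct_add, dotProduct_smul, smul_eq_mul] at h1
      show _ / _ ≤ _
      rw [div_le_iff₀ (htpos _)]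
      linarith
  have hlim : Filter.Tendsto (fun n => ∑ e, ((h e (z + t (σ n) • d) - h e z) / t (σ n)) *
      (h e (z + t (σ n) • d) + h e z) - Q z * (2 * (z ⬝ᵥ d) + t (σ n) * (d ⬝ᵥ d))) Filter.atTop
      (nhds (∑ e, (w e ⬝ᵥ d) * (h e z + h e z) - Q z * (2 * (z ⬝ᵥ d) + 0 * (d ⬝ᵥ d)))) := by
    refine Filter.Tendsto.sub (tendsto_finsetSum _ fun e _ =>
      (hquot e).mul ((hhlim e).add_const _)) ?_
    exact ((hs0.mul_const _).const_add _).const_mul _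
  have hnn : ∀ n, 0 ≤ ∑ e, ((h e (z + t (σ n) • d) - h e z) / t (σ n)) *
      (h e (z + t (σ n) • d) + h e z) - Q z * (2 * (z ⬝ᵥ d) + t (σ n) * (d ⬝ᵥ d)) := by
    intro n
    have hp := htpos (σ n)
    have h1 := hmin (z + t (σ n) • d) (by
      rw [add_dotProduct, smul_dotProduct, hzu, hdu]; simp)
    have h2 : (z + t (σ n) • d) ⬝ᵥ (z + t (σ n) • d) =
        1 + t (σ n) * (2 * (z ⬝ᵥ d) + t (σ n) * (d ⬝ᵥ d)) := by
      simp only [add_dotProduct, dotProduct_add, smul_dotProduct, dotProduct_smul, smul_eq_mul,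
        hz1, dotProduct_comm d z]
      ring
    have h3 : t (σ n) * ∑ e, ((h e (z + t (σ n) • d) - h e z) / t (σ n)) *
      (h e (z + t (σ n) • d) + h e z) = Q (z + t (σ n) • d) - Q z := by
      rw [hQ, Finset.mul_sum]
      simp only
      rw [← Finset.sum_sub_distrib]
      refine Finset.sum_congr rfl fun e _ => ?_
      field_simp
      ring
    rw [h2] at h1
    refine nonneg_of_mul_nonneg_right (a := t (σ n)) ?_ hp
    rw [mul_sub, h3]
    linarith
  have hfin := ge_of_tendsto' hlim hnn
  have hTw := hφ1 _ ⟨w, hwS, rfl⟩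
  rw [hφ, hT, sum_dotProduct] at hTw
  rw [hφ, smul_dotProduct, ← hdd z hzu, smul_eq_mul] at hφ2
  have h5 : ∑ e, (w e ⬝ᵥ d) * (h e z + h e z) = 2 * ∑ e, (h e z • w e) ⬝ᵥ d0 := by
    rw [Finset.mul_sum]
    refine Finset.sum_congr rfl fun e _ => ?_
    rw [smul_dotProduct, ← hdd (w e) (hBu e _ (hwB e trivial)), smul_eq_mul]
    ring
  rw [h5] at hfin
  linarith

/-- **Non-trivial eigenpairs of the normalized submodular Laplacian** (Theorem 3.7).
The normalized Laplacian `ℒ_F` of a submodular transformation with `F(∅) = F(V) = 0`,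
`|V| ≥ 2` and positive degrees has a non-trivial eigenpair, and every non-trivial
eigenpair `(γ, z)` satisfies `γ = ℛ_F(z)`. -/
theorem normLaplacian_nontrivial_eigenpair
    {V E : Type*} [Fintype V] [DecidableEq V] [Fintype E]
    (F : Finset V → E → ℝ)
    (hcard : 2 ≤ Fintype.card V)
    (hsub : ∀ e : E, Submodular (fun S => F S e))
    (hEmpty : ∀ e : E, F ∅ e = 0)
    (hUniv : ∀ e : E, F Finset.univ e = 0)
    (hDeg : ∀ v : V, 0 < deg F v) :
    (∃ (γ : ℝ) (z : V → ℝ), 0 ≤ γ ∧ z ≠ 0 ∧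
      (∑ v, z v * Real.sqrt (deg F v)) = 0 ∧ γ • z ∈ normLaplacian F z) ∧
    (∀ (γ : ℝ) (z : V → ℝ), z ≠ 0 → (∑ v, z v * Real.sqrt (deg F v)) = 0 →
      γ • z ∈ normLaplacian F z → γ = rayleigh F z) := by
  have hs : ∀ v, 0 < Real.sqrt (deg F v) := fun v => Real.sqrt_pos.2 (hDeg v)
  constructor
  · let D : (V → ℝ) →ₗ[ℝ] (V → ℝ) :=
      LinearMap.pi fun v => (Real.sqrt (deg F v))⁻¹ • LinearMap.proj v
    have hD : ∀ w v, D w v = w v / Real.sqrt (deg F v) := by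
      intro w v
      simp [D, div_eq_inv_mul]
    have hDz : ∀ w z : V → ℝ, D w ⬝ᵥ z = ∑ v, w v * (z v / Real.sqrt (deg F v)) := by
      intro w z
      refine Finset.sum_congr rfl fun v _ => ?_
      rw [hD]
      ring
    obtain ⟨a, b, hab⟩ := Fintype.one_lt_card_iff.1 (show 1 < Fintype.card V by omega)
    obtain ⟨γ, z, hγ, hz, hzu, w, hw, hwz⟩ := core_eigen
      (fun e : E => D '' basePolytope (fun S => F S e))
      (fun e => (base_compact _).image D.continuous_of_finiteDimensional)
      (fun e => (base_convex _).linear_image D)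
      (fun e => (base_nonempty _ (hsub e) (hEmpty e)).image _)
      (fun v => Real.sqrt (deg F v))
      (Finset.sum_pos (fun v _ => mul_pos (hs v) (hs v)) ⟨a, Finset.mem_univ a⟩)
      (by
        rintro e _ ⟨w, hw, rfl⟩
        rw [hDz]
        refine Eq.trans ?_ (hw.2.trans (hUniv e))
        refine Finset.sum_congr rfl fun v _ => ?_
        rw [div_self (hs v).ne', mul_one])
      (Pi.single a (Real.sqrt (deg F b)) - Pi.single b (Real.sqrt (deg F a)))
      (by
        intro h
        have := congrFun h a
        simp [hab, (hs b).ne'] at this)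
      (by
        rw [sub_dotProduct, single_dotProduct, single_dotProduct]
        ring)
    refine ⟨γ, z, hγ, hz, hzu, ?_⟩
    choose hwB hwm using hw
    choose w' hw'B hw' using hwB
    refine ⟨_, ⟨w', fun e => ⟨hw'B e, fun y hy => ?_⟩, rfl⟩, ?_⟩
    · rw [← hDz, ← hDz, hw']
      exact hwm e _ ⟨y, hy, rfl⟩
    · rw [hwz]
      ext v
      rw [Finset.sum_apply, Finset.sum_div]
      refine Finset.sum_congr rfl fun e _ => ?_
      rw [← hDz, hw', Pi.smul_apply, smul_eq_mul]
      conv_lhs => rw [← hw', hD]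
      rw [hw', mul_div_assoc]
  · rintro γ z hz - ⟨y, ⟨w, hw, rfl⟩, hy⟩
    have hp : 0 < ∑ v, z v ^ 2 := by
      obtain ⟨v, hv⟩ := Function.ne_iff.1 hz
      exact Finset.sum_pos' (fun i _ => sq_nonneg _)
        ⟨v, Finset.mem_univ v, by have : z v ≠ 0 := hv; positivity⟩
    unfold rayleigh
    rw [eq_div_iff hp.ne']
    have hl : ∀ e, lovasz (fun S => F S e) (fun v => z v / Real.sqrt (deg F v)) =
        ∑ v, w e v * (z v / Real.sqrt (deg F v)) := by
      intro e
      refine IsGreatest.csSup_eq ⟨⟨w e, (hw e).1, rfl⟩, ?_⟩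
      rintro _ ⟨y, hy, rfl⟩
      exact (hw e).2 y hy
    have hyv : ∀ v, γ * z v = _ := fun v => congrFun hy v
    rw [Finset.mul_sum]
    calc ∑ v, γ * z v ^ 2 = ∑ v, (γ * z v) * z v :=
          Finset.sum_congr rfl fun v _ => by ring
      _ = ∑ v, ∑ e, (∑ u, w e u * (z u / Real.sqrt (deg F u))) *
            (w e v * (z v / Real.sqrt (deg F v))) := by
          refine Finset.sum_congr rfl fun v _ => ?_
          rw [hyv v]
          simp only
          rw [Finset.sum_div, Finset.sum_mul]
          refine Finset.sum_congr rfl fun e _ => ?_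
          ring
      _ = _ := by
          rw [Finset.sum_comm]
          refine Finset.sum_congr rfl fun e _ => ?_
          rw [← Finset.mul_sum, hl, sq]
end

section
/- Let F : 2^V → ℝ^E be a submodular transformation with F(∅) = 0. Then the Laplacian L_F is positive-semidefinite: for every λ ∈ ℝ and every nonzero x ∈ ℝ^V with λ x ∈ L_F(x), we have λ ≥ 0. -/
open Finset

variable {V E : Type*}

/-- **Positive semidefiniteness of the submodular Laplacian** (Lemma 3.4).
Every eigenvalue of `L_F` is non-negative. -/
theorem laplacian_positive_semidefinite
    {V E : Type*} [Fintype V] [DecidableEq V] [Fintype E]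
    (F : Finset V → E → ℝ)
    (hsub : ∀ e : E, Submodular (fun S => F S e))
    (hEmpty : ∀ e : E, F ∅ e = 0) :
    ∀ (lam : ℝ) (x : V → ℝ), x ≠ 0 → lam • x ∈ laplacian F x → 0 ≤ lam := by
  intro lam x hx hmem
  obtain ⟨w, -, hz⟩ := hmem
  have h1 : ∑ v, (lam • x) v * x v = ∑ e : E, (∑ u, w e u * x u) ^ 2 := by
    rw [hz]
    calc ∑ v, (∑ e : E, (∑ u, w e u * x u) * w e v) * x v
        = ∑ v, ∑ e : E, (∑ u, w e u * x u) * (w e v * x v) := by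
          refine Finset.sum_congr rfl fun v _ => ?_
          rw [Finset.sum_mul]
          exact Finset.sum_congr rfl fun e _ => mul_assoc _ _ _
      _ = ∑ e : E, (∑ u, w e u * x u) ^ 2 := by
          rw [Finset.sum_comm]
          refine Finset.sum_congr rfl fun e _ => ?_
          rw [← Finset.mul_sum, sq]
  have h2 : ∑ v, (lam • x) v * x v = lam * ∑ v, x v ^ 2 := by
    rw [Finset.mul_sum]
    refine Finset.sum_congr rfl fun v _ => ?_
    simp only [Pi.smul_apply, smul_eq_mul]
    ring
  have h3 : 0 < ∑ v, x v ^ 2 := by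
    obtain ⟨v, hv⟩ := Function.ne_iff.mp hx
    exact Finset.sum_pos' (fun i _ => sq_nonneg _) ⟨v, Finset.mem_univ v, lt_of_le_of_ne (sq_nonneg _) (Ne.symm (pow_ne_zero 2 hv))⟩
  have h4 : 0 ≤ lam * ∑ v, x v ^ 2 := by
    rw [← h2, h1]
    exact Finset.sum_nonneg fun e _ => sq_nonneg _
  exact nonneg_of_mul_nonneg_left h4 h3
end

section
/- Let F : 2^V → ℝ^E be a submodular transformation with F(∅) = 0 such that d_F(v) > 0 for every v ∈ V, and let x ∈ [0,1]^V satisfy ∑_{v∈V} d_F(v) x(v) > 0. Then there exists a set S with ∅ ≠ S ⊆ supp(x) such that cut_F(S) / vol_F(S) ≤ (∑_{e∈E} f_e(x)) / (∑_{v∈V} d_F(v) x(v)), where supp(x) = {v ∈ V : x(v) ≠ 0}. -/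
open Finset

variable {V E : Type*}

section helpers

variable {V : Type*} [Fintype V] [DecidableEq V]

def pre (r : V → ℕ) (k : ℕ) : Finset V := Finset.univ.filter (fun v => r v < k)

theorem pre_succ (r : V → ℕ) (hr : Function.Injective r) (k : ℕ) :
    pre r (k+1) = pre r k ∨ ∃ v, r v = k ∧ v ∉ pre r k ∧ pre r (k+1) = insert v (pre r k) := by
  by_cases h : ∃ v, r v = k
  · obtain ⟨v, hv⟩ := h
    refine Or.inr ⟨v, hv, by simp [pre, hv], ?_⟩
    ext u
    simp only [pre, Finset.mem_filter, Finset.mem_univ, true_and, Finset.mem_insert]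
    constructor
    · intro hu
      rcases Nat.lt_succ_iff_lt_or_eq.mp hu with h | h
      · exact Or.inr h
      · exact Or.inl (hr (h.trans hv.symm))
    · rintro (rfl | h) <;> omega
  · refine Or.inl ?_
    ext u
    have : r u ≠ k := fun e => h ⟨u, e⟩
    simp only [pre, Finset.mem_filter, Finset.mem_univ, true_and]
    omega

theorem exists_rank (x : V → ℝ) : ∃ r : V → ℕ, Function.Injective r ∧
    (∀ u v, r u < r v → x v ≤ x u) ∧ pre r (Fintype.card V) = Finset.univ := by
  let e := Fintype.equivFin V
  let y : Fin (Fintype.card V) → ℝ := fun i => - x (e.symm i)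
  let s := Tuple.sort y
  have hs : Monotone (y ∘ s) := Tuple.monotone_sort y
  refine ⟨fun v => (s.symm (e v)).val, ?_, ?_, ?_⟩
  · intro u v h
    have := Fin.ext h
    simpa using this
  · intro u v h
    have h2 : s.symm (e u) ≤ s.symm (e v) := le_of_lt h
    have := hs h2
    simp [y] at this
    exact this
  · ext v
    simp [pre]

noncomputable def greedy (G : Finset V → ℝ) (r : V → ℕ) (v : V) : ℝ :=
  G (pre r (r v + 1)) - G (pre r (r v))

theorem greedy_pre (G : Finset V → ℝ) (h0 : G ∅ = 0) (r : V → ℕ) (hr : Function.Injective r)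
    (k : ℕ) : ∑ v ∈ pre r k, greedy G r v = G (pre r k) := by
  induction k with
  | zero => simp [pre, h0]
  | succ k ih =>
    rcases pre_succ r hr k with h | ⟨v, hv, hn, h⟩
    · rw [h, ih]
    · conv_lhs => rw [h]
      rw [Finset.sum_insert hn, ih, greedy, hv]
      ring

theorem greedy_le (G : Finset V → ℝ) (hG : Submodular G) (h0 : G ∅ = 0) (r : V → ℕ)
    (hr : Function.Injective r) (T : Finset V)
    (k : ℕ) : ∑ v ∈ T ∩ pre r k, greedy G r v ≤ G (T ∩ pre r k) := by
  induction k with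
  | zero => simp [pre, h0]
  | succ k ih =>
    rcases pre_succ r hr k with h | ⟨v, hv, hn, h⟩
    · rw [h]; exact ih
    · by_cases hT : v ∈ T
      · have h1 : T ∩ pre r (k+1) = insert v (T ∩ pre r k) := by
          rw [h, Finset.inter_insert_of_mem hT]
        have h2 := hG (pre r k) (T ∩ pre r (k+1))
        have h3 : pre r k ∪ T ∩ pre r (k+1) = pre r (k+1) := by
          rw [h1, h]; ext u; simp; tauto
        have h4 : pre r k ∩ (T ∩ pre r (k+1)) = T ∩ pre r k := by
          rw [h]; ext u; simp; tauto
        rw [h3, h4] at h2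
        have h5 : v ∉ T ∩ pre r k := by simp [hn]
        conv_lhs => rw [h1]
        rw [Finset.sum_insert h5, greedy, hv]
        linarith
      · have h1 : T ∩ pre r (k+1) = T ∩ pre r k := by
          rw [h, Finset.inter_insert_of_notMem hT]
        rw [h1]; exact ih

theorem greedy_mem (G : Finset V → ℝ) (hG : Submodular G) (h0 : G ∅ = 0) (r : V → ℕ)
    (hr : Function.Injective r) (hu : pre r (Fintype.card V) = Finset.univ) :
    greedy G r ∈ basePolytope G := by
  refine ⟨fun T => ?_, ?_⟩
  · have := greedy_le G hG h0 r hr T (Fintype.card V)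
    simpa [hu] using this
  · have := greedy_pre G h0 r hr (Fintype.card V)
    simpa [hu] using this

theorem le_lovasz (G : Finset V → ℝ) (x : V → ℝ) (hx : ∀ v, 0 ≤ x v) (w : V → ℝ)
    (hw : w ∈ basePolytope G) : ∑ v, w v * x v ≤ lovasz G x := by
  refine le_csSup ⟨∑ v, G {v} * x v, ?_⟩ ⟨w, hw, rfl⟩
  rintro _ ⟨w', hw', rfl⟩
  refine Finset.sum_le_sum fun v _ => mul_le_mul_of_nonneg_right ?_ (hx v)
  simpa using hw'.1 {v}

theorem abel (r : V → ℕ) (hr : Function.Injective r) (x H : V → ℝ) (hx : ∀ v, 0 ≤ x v)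
    (hmono : ∀ u v, r u < r v → x v ≤ x u)
    (hH : ∀ k, (pre r k).Nonempty → (∀ v ∈ pre r k, x v ≠ 0) → 0 ≤ ∑ v ∈ pre r k, H v) (k : ℕ) :
    ∀ c, 0 ≤ c → (∀ v ∈ pre r k, c ≤ x v) →
      c * ∑ v ∈ pre r k, H v ≤ ∑ v ∈ pre r k, H v * x v := by
  induction k with
  | zero => intro c _ _; simp [pre]
  | succ k ih =>
    rcases pre_succ r hr k with h | ⟨v, hv, hn, h⟩
    · rw [h]; exact ih
    · intro c hc hcx
      have hvx : ∀ u ∈ pre r k, x v ≤ x u := fun u hu => hmono u v (by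
        simp [pre] at hu; omega)
      have h1 := ih (x v) (hx v) hvx
      have hcv : c ≤ x v := hcx v (by rw [h]; simp)
      have h2 : c * ∑ v ∈ pre r (k+1), H v ≤ x v * ∑ v ∈ pre r (k+1), H v := by
        by_cases h0 : x v = 0
        · have : c = 0 := by linarith
          rw [this, h0]
        · refine mul_le_mul_of_nonneg_right hcv (hH _ ⟨v, by rw [h]; simp⟩ ?_)
          intro u hu
          have hp : 0 < x v := lt_of_le_of_ne (hx v) (Ne.symm h0)
          rw [h, Finset.mem_insert] at hu
          rcases hu with rfl | hu
          · exact h0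
          · exact (lt_of_lt_of_le hp (hvx u hu)).ne'
      refine h2.trans ?_
      rw [h, Finset.sum_insert hn, Finset.sum_insert hn]
      linarith

end helpers

/-- **Sweep rounding, positive case** (Lemma 4.4). For `x ∈ [0,1]^V` with
`∑_v d_F(v) x(v) > 0`, there is a nonempty set `S ⊆ supp(x)` with
`cut_F(S) / vol_F(S) ≤ (∑_e f_e(x)) / (∑_v d_F(v) x(v))`. -/
theorem sweep_rounding_pos
    {V E : Type*} [Fintype V] [DecidableEq V] [Fintype E]
    (F : Finset V → E → ℝ)
    (hsub : ∀ e : E, Submodular (fun S => F S e))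
    (hEmpty : ∀ e : E, F ∅ e = 0)
    (hDeg : ∀ v : V, 0 < deg F v)
    (x : V → ℝ) (hx : ∀ v, x v ∈ Set.Icc (0:ℝ) 1)
    (hpos : 0 < ∑ v, deg F v * x v) :
    ∃ S : Finset V, S.Nonempty ∧ (∀ v ∈ S, x v ≠ 0) ∧
      cutF F S / volF F S ≤
        (∑ e : E, lovasz (fun S => F S e) x) / (∑ v, deg F v * x v) := by
  classical
  have hx0 : ∀ v, 0 ≤ x v := fun v => (hx v).1
  obtain ⟨r, hr, hmono, hu⟩ := exists_rank x
  let A : Finset (Finset V) :=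
    Finset.univ.filter (fun S => S.Nonempty ∧ ∀ v ∈ S, x v ≠ 0)
  have hA : A.Nonempty := by
    obtain ⟨v, _, hv⟩ := Finset.exists_ne_zero_of_sum_ne_zero hpos.ne'
    refine ⟨{v}, ?_⟩
    simp only [A, Finset.mem_filter, Finset.mem_univ, true_and, Finset.singleton_nonempty,
      Finset.mem_singleton, forall_eq]
    exact right_ne_zero_of_mul hv
  obtain ⟨S, hS, hmin⟩ := Finset.exists_min_image A (fun S => cutF F S / volF F S) hA
  simp only [A, Finset.mem_filter, Finset.mem_univ, true_and] at hS hmin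
  refine ⟨S, hS.1, hS.2, ?_⟩
  set μ := cutF F S / volF F S with hμ
  rw [le_div_iff₀ hpos]
  let w : E → V → ℝ := fun e => greedy (fun S => F S e) r
  have h1 : ∑ e, ∑ v, w e v * x v ≤ ∑ e : E, lovasz (fun S => F S e) x :=
    Finset.sum_le_sum fun e _ => le_lovasz _ x hx0 _
      (greedy_mem _ (hsub e) (hEmpty e) r hr hu)
  have h2 := abel r hr x (fun v => ∑ e, w e v - μ * deg F v) hx0 hmono (by
    intro k hne hk
    have h3 := hmin _ ⟨hne, hk⟩
    have hvol : 0 < volF F (pre r k) := Finset.sum_pos (fun v _ => hDeg v) hne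
    rw [le_div_iff₀ hvol] at h3
    rw [Finset.sum_sub_distrib, Finset.sum_comm, ← Finset.mul_sum]
    have h4 : ∑ e, ∑ v ∈ pre r k, w e v = cutF F (pre r k) :=
      Finset.sum_congr rfl fun e _ => greedy_pre (fun S => F S e) (hEmpty e) r hr k
    rw [h4]
    unfold volF at h3
    linarith) (Fintype.card V) 0 le_rfl (fun v _ => hx0 v)
  rw [hu, zero_mul] at h2
  simp only [sub_mul, Finset.sum_sub_distrib, Finset.sum_mul] at h2
  rw [Finset.sum_comm] at h2
  have h5 : ∑ v, μ * deg F v * x v = μ * ∑ v, deg F v * x v := by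
    rw [Finset.mul_sum]; exact Finset.sum_congr rfl fun v _ => by ring
  linarith
end

section
/- Let F : 2^V → ℝ^E be a submodular transformation with F(∅) = 0 and F(V) = 0 such that d_F(v) > 0 for every v ∈ V, and let x ∈ [-1,0]^V satisfy ∑_{v∈V} d_F(v) x(v) < 0. Then there exists a set S with ∅ ≠ S ⊆ supp(x) such that cut_F(V ∖ S) / vol_F(S) ≤ −(∑_{e∈E} f_e(x)) / (∑_{v∈V} d_F(v) x(v)), where supp(x) = {v ∈ V : x(v) ≠ 0}. -/
open Finset

variable {V E : Type*}

theorem abel_aux (n : ℕ) (h b : ℕ → ℝ) (hb0 : b 0 = 0)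
    (hmono : ∀ k < n, b (k+1) ≤ b k) (hh : ∀ k < n, b (k+1) < 0 → 0 < h k) :
    ∀ k ≤ n, b k ≤ 0 ∧ h k * b k ≤ ∑ i ∈ Finset.range k, (h (i+1) - h i) * b (i+1) ∧
      (b k < 0 → h k * b k < ∑ i ∈ Finset.range k, (h (i+1) - h i) * b (i+1)) := by
  intro k
  induction k with
  | zero => intro _; simp [hb0]
  | succ k ih =>
    intro hk
    obtain ⟨h1, h2, h3⟩ := ih (by omega)
    have hm := hmono k (by omega)
    have hp := hh k (by omega)
    rw [Finset.sum_range_succ]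
    have key : b (k+1) < 0 → h (k+1) * b (k+1) <
        ∑ i ∈ Finset.range k, (h (i+1) - h i) * b (i+1) + (h (k+1) - h k) * b (k+1) := by
      intro hlt
      have hp' := hp hlt
      rcases hm.lt_or_eq with hc | hc
      · nlinarith [mul_pos hp' (sub_pos.2 hc)]
      · have := h3 (by linarith)
        rw [hc]; linarith
    refine ⟨by linarith, ?_, key⟩
    rcases (show b (k+1) ≤ 0 by linarith).lt_or_eq with hc | hc
    · exact (key hc).le
    · have hb : b k = 0 := by linarith
      rw [hb] at h2
      rw [hc]; linarith

theorem lovasz_ge {V : Type*} [Fintype V] [DecidableEq V] (G : Finset V → ℝ)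
    (x : V → ℝ) (hx : ∀ v, x v ≤ 0) (w : V → ℝ) (hw : w ∈ basePolytope G) :
    ∑ v, w v * x v ≤ lovasz G x := by
  unfold lovasz
  apply le_csSup
  · refine ⟨∑ v, (G Finset.univ - G {v}ᶜ) * x v, ?_⟩
    rintro _ ⟨u, ⟨hu1, hu2⟩, rfl⟩
    apply Finset.sum_le_sum
    intro v _
    apply mul_le_mul_of_nonpos_right _ (hx v)
    have h1 := hu1 {v}ᶜ
    have h2 := Finset.sum_add_sum_compl {v} u
    rw [Finset.sum_singleton] at h2
    linarith
  · exact ⟨w, hw, rfl⟩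

theorem greedy_mem_s9 {V : Type*} [Fintype V] [DecidableEq V] (G : Finset V → ℝ)
    (hsub : Submodular G) (hE : G ∅ = 0) (r : V → ℕ) (hr : Function.Injective r)
    (L : ℕ → Finset V) (hL : ∀ k v, v ∈ L k ↔ r v < k)
    (htot : ∑ v, (G (L (r v + 1)) - G (L (r v))) = G Finset.univ) :
    (fun v => G (L (r v + 1)) - G (L (r v))) ∈ basePolytope G := by
  refine ⟨?_, htot⟩
  intro S
  induction S using Finset.induction_on_max_value r with
  | empty => simp [hE]
  | insert v S hv hmax ih =>
    rw [Finset.sum_insert hv]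
    have h := hsub (insert v S) (L (r v))
    have h1 : insert v S ∪ L (r v) = L (r v + 1) := by
      ext u
      simp only [Finset.mem_union, Finset.mem_insert, hL]
      constructor
      · rintro ((rfl | hu) | hu)
        · omega
        · have := hmax u hu; omega
        · omega
      · intro hu
        by_cases hc : r u = r v
        · exact Or.inl (Or.inl (hr hc))
        · right; omega
    have h2 : insert v S ∩ L (r v) = S := by
      ext u
      simp only [Finset.mem_inter, Finset.mem_insert, hL]
      constructor
      · rintro ⟨rfl | hu, h⟩
        · omega
        · exact hu
      · intro hu
        refine ⟨Or.inr hu, lt_of_le_of_ne (hmax u hu) ?_⟩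
        intro hc
        exact hv (hr hc ▸ hu)
    rw [h1, h2] at h
    linarith

/-- **Sweep rounding, negative case** (Corollary 4.5). For `x ∈ [-1,0]^V` with
`∑_v d_F(v) x(v) < 0`, there is a nonempty set `S ⊆ supp(x)` with
`cut_F(V∖S) / vol_F(S) ≤ -(∑_e f_e(x)) / (∑_v d_F(v) x(v))`. -/
theorem sweep_rounding_neg
    {V E : Type*} [Fintype V] [DecidableEq V] [Fintype E]
    (F : Finset V → E → ℝ)
    (hsub : ∀ e : E, Submodular (fun S => F S e))
    (hEmpty : ∀ e : E, F ∅ e = 0)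
    (hUniv : ∀ e : E, F Finset.univ e = 0)
    (hDeg : ∀ v : V, 0 < deg F v)
    (x : V → ℝ) (hx : ∀ v, x v ∈ Set.Icc (-1:ℝ) 0)
    (hneg : (∑ v, deg F v * x v) < 0) :
    ∃ S : Finset V, S.Nonempty ∧ (∀ v ∈ S, x v ≠ 0) ∧
      cutF F Sᶜ / volF F S ≤
        -((∑ e : E, lovasz (fun S => F S e) x) / (∑ v, deg F v * x v)) := by
  by_contra! hcon
  obtain ⟨n, σ, hσ⟩ : ∃ (n : ℕ) (σ : Fin n ≃ V), Antitone (fun i => x (σ i)) := by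
    let e := Fintype.equivFin V
    refine ⟨Fintype.card V, (Tuple.sort (fun i => - x (e.symm i))).trans e.symm, ?_⟩
    intro i j hij
    have := Tuple.monotone_sort (fun i => - x (e.symm i)) hij
    simpa using this
  set c := -((∑ e : E, lovasz (fun S => F S e) x) / (∑ v, deg F v * x v)) with hc
  have hc' : c * (∑ v, deg F v * x v) = -∑ e : E, lovasz (fun S => F S e) x := by
    rw [hc]; field_simp [hneg.ne]
  let r : V → ℕ := fun v => (σ.symm v).val
  have hr : Function.Injective r := Fin.val_injective.comp σ.symm.injective
  let L : ℕ → Finset V := fun k => Finset.univ.filter (fun v => r v < k)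
  have hL : ∀ k v, v ∈ L k ↔ r v < k := by intro k v; simp [L]
  have hL0 : L 0 = ∅ := by ext v; simp [hL]
  have hLn : L n = Finset.univ := by ext v; simp [hL, r]
  have hsum : ∀ (φ : ℕ → V → ℝ), ∑ v, φ (r v) v =
      ∑ i ∈ Finset.range n, (if h : i < n then φ i (σ ⟨i, h⟩) else 0) := by
    intro φ
    rw [← σ.sum_comp, Finset.sum_range]
    simp [r]
  have htot : ∀ g : ℕ → ℝ, ∑ v, (g (r v + 1) - g (r v)) = g n - g 0 := by
    intro g
    rw [hsum (fun i _ => g (i+1) - g i), ← Finset.sum_range_sub]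
    apply Finset.sum_congr rfl
    intro i hi
    rw [dif_pos (Finset.mem_range.1 hi)]
  have hmem : ∀ e, (fun v => F (L (r v + 1)) e - F (L (r v)) e) ∈
      basePolytope (fun S => F S e) := by
    intro e
    apply greedy_mem_s9 (fun S => F S e) (hsub e) (hEmpty e) r hr L hL
    rw [htot (fun k => F (L k) e)]
    simp [hL0, hLn, hEmpty]
  have hlow : ∑ e, ∑ v, (F (L (r v + 1)) e - F (L (r v)) e) * x v ≤
      ∑ e : E, lovasz (fun S => F S e) x :=
    Finset.sum_le_sum fun e _ => lovasz_ge (fun S => F S e) x (fun v => (hx v).2) _ (hmem e)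
  let h : ℕ → ℝ := fun k => cutF F (L k) - c * volF F (L k)ᶜ
  have hstep : ∀ v, h (r v + 1) - h (r v) =
      ∑ e, (F (L (r v + 1)) e - F (L (r v)) e) + c * deg F v := by
    intro v
    have : (L (r v))ᶜ = insert v (L (r v + 1))ᶜ := by
      ext u
      simp only [Finset.mem_insert, Finset.mem_compl, hL]
      constructor
      · intro hu
        by_cases hc : r u = r v
        · exact Or.inl (hr hc)
        · right; omega
      · rintro (rfl | hu) <;> omega
    simp only [h, cutF, volF, this]
    rw [Finset.sum_insert (by simp [hL]), Finset.sum_sub_distrib]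
    ring
  have hle : ∑ v, (h (r v + 1) - h (r v)) * x v ≤ 0 := by
    have : ∑ v, (h (r v + 1) - h (r v)) * x v =
        ∑ e, ∑ v, (F (L (r v + 1)) e - F (L (r v)) e) * x v + c * ∑ v, deg F v * x v := by
      rw [Finset.sum_comm, Finset.mul_sum, ← Finset.sum_add_distrib]
      apply Finset.sum_congr rfl
      intro v _
      rw [hstep, add_mul, Finset.sum_mul]; ring
    rw [this, hc']; linarith
  let b : ℕ → ℝ := fun k => match k with
    | 0 => 0
    | k+1 => if hk : k < n then x (σ ⟨k, hk⟩) else 0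
  have hbs : ∀ k (hk : k < n), b (k+1) = x (σ ⟨k, hk⟩) := by
    intro k hk; simp [b, hk]
  have hab := abel_aux n h b rfl (by
      intro k hk
      rw [hbs k hk]
      cases k with
      | zero => exact (hx _).2
      | succ k =>
        rw [hbs k (by omega)]
        exact hσ (by simp)) (by
      intro k hk hlt
      rw [hbs k hk] at hlt
      have hne : (L k)ᶜ.Nonempty := ⟨σ ⟨k, hk⟩, by simp [hL, r]⟩
      have h1 := hcon (L k)ᶜ hne (by
        intro v hv
        simp only [Finset.mem_compl, hL, not_lt] at hv
        have : x (σ (σ.symm v)) ≤ x (σ ⟨k, hk⟩) := hσ (by simpa [Fin.le_def] using hv)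
        rw [Equiv.apply_symm_apply] at this
        linarith)
      have hv : 0 < volF F (L k)ᶜ := Finset.sum_pos (fun v _ => hDeg v) hne
      rw [compl_compl, lt_div_iff₀ hv] at h1
      simp only [h]; linarith) n le_rfl
  have hhn : h n = 0 := by simp [h, hLn, cutF, volF, hUniv]
  rw [hsum (fun i v => (h (i+1) - h i) * x v)] at hle
  have heq : ∑ i ∈ Finset.range n, (h (i+1) - h i) * b (i+1) =
      ∑ i ∈ Finset.range n,
        (if hi : i < n then (h (i+1) - h i) * x (σ ⟨i, hi⟩) else 0) := by
    apply Finset.sum_congr rfl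
    intro i hi
    rw [dif_pos (Finset.mem_range.1 hi), hbs i (Finset.mem_range.1 hi)]
  have hbn : b n < 0 := by
    obtain ⟨v, -, hv⟩ : ∃ v ∈ Finset.univ, deg F v * x v < 0 := by
      by_contra! hh
      exact absurd (Finset.sum_nonneg hh) (not_le.2 hneg)
    have hxv : x v < 0 := by
      by_contra! hh
      exact absurd (mul_nonneg (hDeg v).le hh) (not_le.2 hv)
    have hlt := (σ.symm v).isLt
    obtain ⟨m, rfl⟩ : ∃ m, n = m + 1 := ⟨n - 1, by omega⟩
    rw [hbs m (by omega)]
    have : x (σ ⟨m, by omega⟩) ≤ x (σ (σ.symm v)) := hσ (by rw [Fin.le_def]; simp; omega)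
    rw [Equiv.apply_symm_apply] at this
    linarith
  have := hab.2.2 hbn
  rw [heq, hhn, zero_mul] at this
  linarith
end

section
/- Let F : 2^V → ℝ be a submodular function with F(∅) = 0 and let f : ℝ^V → ℝ be its Lovász extension. If f is non-negative (f(x) ≥ 0 for all x ∈ ℝ^V), then for every x ∈ ℝ^V, f(x₊)² + f(x₋)² ≤ f(x)², where x₊(v) = max{x(v), 0} and x₋(v) = min{x(v), 0} for each v ∈ V. -/
open Finset

variable {V E : Type*}

theorem greedy_aux {V : Type*} [DecidableEq V] (F : Finset V → ℝ)
    (hsub : Submodular F) (hEmpty : F ∅ = 0) (x : V → ℝ) (S : Finset V) :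
    ∃ w : V → ℝ, (∀ T ⊆ S, ∑ v ∈ T, w v ≤ F T) ∧ ∑ v ∈ S, w v = F S ∧
      ∀ w' : V → ℝ, (∀ T ⊆ S, ∑ v ∈ T, w' v ≤ F T) →
      ∀ y : V → ℝ, (∀ u v, x u ≤ x v → y u ≤ y v) → ∀ c : ℝ, (∀ v ∈ S, c ≤ y v) →
      0 ≤ ∑ v ∈ S, (w v - w' v) * (y v - c) := by
  induction S using Finset.induction_on_min_value x with
  | empty =>
    refine ⟨0, ?_, ?_, ?_⟩
    · intro T hT
      rw [Finset.subset_empty.mp hT]; simp [hEmpty]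
    · simp [hEmpty]
    · intros; simp
  | insert a S ha hmin ih =>
    obtain ⟨w, h1, h2, h3⟩ := ih
    have hc : ∀ T ⊆ S, ∑ v ∈ T, Function.update w a (F (insert a S) - F S) v
        = ∑ v ∈ T, w v := by
      intro T hT
      refine Finset.sum_congr rfl fun v hv => ?_
      rw [Function.update_of_ne]
      rintro rfl
      exact ha (hT hv)
    have htot : ∑ v ∈ insert a S, Function.update w a (F (insert a S) - F S) v
        = F (insert a S) := by
      rw [Finset.sum_insert ha, hc S subset_rfl, h2, Function.update_self]; ring
    refine ⟨Function.update w a (F (insert a S) - F S), ?_, htot, ?_⟩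
    · intro T hT
      by_cases haT : a ∈ T
      · have hTe : T.erase a ⊆ S := by
          intro v hv
          rw [Finset.mem_erase] at hv
          exact (Finset.mem_insert.mp (hT hv.2)).resolve_left hv.1
        rw [← Finset.add_sum_erase T _ haT, hc _ hTe, Function.update_self]
        have hs := hsub T S
        have e1 : T ∪ S = insert a S := by
          ext v
          simp only [Finset.mem_union, Finset.mem_insert]
          constructor
          · rintro (h | h)
            · exact Finset.mem_insert.mp (hT h)
            · exact Or.inr h
          · rintro (rfl | h)
            · exact Or.inl haT
            · exact Or.inr h
        have e2 : T ∩ S = T.erase a := by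
          ext v
          simp only [Finset.mem_inter, Finset.mem_erase]
          constructor
          · rintro ⟨h, h'⟩
            exact ⟨fun e => ha (e ▸ h'), h⟩
          · rintro ⟨h, h'⟩
            exact ⟨h', hTe (Finset.mem_erase.mpr ⟨h, h'⟩)⟩
        rw [e1, e2] at hs
        have := h1 _ hTe
        linarith
      · have hTS : T ⊆ S := by
          intro v hv
          exact (Finset.mem_insert.mp (hT hv)).resolve_left (fun e => haT (e ▸ hv))
        rw [hc _ hTS]; exact h1 _ hTS
    · intro w' hw' y hy c hcy
      have ih := h3 w' (fun T hT => hw' T (hT.trans (Finset.subset_insert a S))) y hy (y a)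
        (fun v hv => hy _ _ (hmin v hv))
      have hW := hw' _ subset_rfl
      have hya := hcy a (Finset.mem_insert_self a S)
      generalize hg : Function.update w a (F (insert a S) - F S) = g at *
      have hgw : ∀ v ∈ S, g v = w v := by
        intro v hv
        rw [← hg, Function.update_of_ne]
        rintro rfl
        exact ha hv
      have key : ∑ v ∈ insert a S, (g v - w' v) * (y v - c)
          = ∑ v ∈ S, (w v - w' v) * (y v - y a)
            + (y a - c) * (∑ v ∈ insert a S, g v - ∑ v ∈ insert a S, w' v) := by
        rw [← Finset.sum_sub_distrib, Finset.sum_insert ha, Finset.sum_insert ha, mul_add,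
          Finset.mul_sum, add_left_comm, ← Finset.sum_add_distrib, mul_comm (y a - c)]
        congr 1
        refine Finset.sum_congr rfl fun v hv => ?_
        rw [hgw v hv]; ring
      rw [key]
      have := mul_nonneg (sub_nonneg.mpr hya) (sub_nonneg.mpr (htot ▸ hW))
      linarith

theorem lovasz_common {V : Type*} [Fintype V] [DecidableEq V] (F : Finset V → ℝ)
    (hsub : Submodular F) (hEmpty : F ∅ = 0) (x : V → ℝ) :
    ∃ w : V → ℝ, ∀ y : V → ℝ, (∀ u v, x u ≤ x v → y u ≤ y v) →
      lovasz F y = ∑ v, w v * y v := by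
  obtain ⟨w, h1, h2, h3⟩ := greedy_aux F hsub hEmpty x Finset.univ
  refine ⟨w, fun y hy => ?_⟩
  apply IsGreatest.csSup_eq
  refine ⟨⟨w, ⟨fun S => h1 S (Finset.subset_univ S), h2⟩, rfl⟩, ?_⟩
  rintro _ ⟨w', ⟨hw1, hw2⟩, rfl⟩
  obtain ⟨c, hc⟩ := (Set.finite_range y).bddBelow
  have h := h3 w' (fun T _ => hw1 T) y hy c (fun v _ => hc ⟨v, rfl⟩)
  have e : ∑ v, (w v - w' v) * (y v - c)
      = ∑ v, w v * y v - ∑ v, w' v * y v - c * (∑ v, w v - ∑ v, w' v) := by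
    rw [← Finset.sum_sub_distrib, ← Finset.sum_sub_distrib, Finset.mul_sum,
      ← Finset.sum_sub_distrib]
    exact Finset.sum_congr rfl fun v _ => by ring
  rw [e, h2, hw2] at h
  show ∑ v, w' v * y v ≤ _
  linarith

/-- **Reverse triangle-type inequality** (Lemma 4.6). If the Lovász extension `f` of a
submodular function `F` with `F(∅) = 0` is non-negative, then
`f(x₊)² + f(x₋)² ≤ f(x)²`, where `x₊ = max(x,0)` and `x₋ = min(x,0)` coordinate-wise. -/
theorem lovasz_sq_pos_neg_le
    {V : Type*} [Fintype V] [DecidableEq V]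
    (F : Finset V → ℝ)
    (hsub : Submodular F)
    (hEmpty : F ∅ = 0)
    (hNonneg : ∀ x : V → ℝ, 0 ≤ lovasz F x) :
    ∀ x : V → ℝ,
      (lovasz F (fun v => max (x v) 0))^2 + (lovasz F (fun v => min (x v) 0))^2 ≤
        (lovasz F x)^2 := by
  intro x
  obtain ⟨w, hw⟩ := lovasz_common F hsub hEmpty x
  have hp := hw (fun v => max (x v) 0) (fun u v h => max_le_max_right 0 h)
  have hm := hw (fun v => min (x v) 0) (fun u v h => min_le_min_right 0 h)
  have hx := hw x (fun u v h => h)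
  have e : lovasz F x = lovasz F (fun v => max (x v) 0) + lovasz F (fun v => min (x v) 0) := by
    rw [hp, hm, hx, ← Finset.sum_add_distrib]
    refine Finset.sum_congr rfl fun v _ => ?_
    rw [← mul_add, max_add_min, add_zero]
  rw [e]
  nlinarith [mul_nonneg (hNonneg (fun v => max (x v) 0)) (hNonneg (fun v => min (x v) 0))]
end

section
/- Let n ≥ 2 and let X₁, X₂, …, Xₙ be real random variables on a common probability space, not necessarily independent, such that each Xᵢ is Gaussian with mean μᵢ and variance σᵢ² (so E[Xᵢ] = μᵢ and E[Xᵢ²] = μᵢ² + σᵢ²). Let λ = maxᵢ √(μᵢ² + σᵢ²). Then E[ maxᵢ Xᵢ² ] ≤ 4 λ² log n and E[ maxᵢ |Xᵢ| ] ≤ 2 λ √(log n). -/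
open MeasureTheory ProbabilityTheory
open scoped NNReal

lemma aux_exp (m : ℝ) (v : ℝ≥0) (L : ℝ) (hL : 0 < L) (h : m^2 + v ≤ L) :
    Integrable (fun x => Real.exp (3 / (8 * L) * x^2)) (gaussianReal m v) ∧
    ∫ x, Real.exp (3 / (8 * L) * x^2) ∂(gaussianReal m v) ≤ 2 := by
  by_cases hv : v = 0
  · subst hv
    simp only [gaussianReal_zero_var]
    refine ⟨integrable_dirac (by simp), ?_⟩
    rw [integral_dirac]
    have h1 : 3 / (8 * L) * m^2 ≤ 1/2 := by
      rw [div_mul_eq_mul_div, div_le_iff₀ (by positivity)]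
      simp at h; nlinarith
    have h2 := Real.log_two_gt_d9
    calc Real.exp (3 / (8 * L) * m^2) ≤ Real.exp (Real.log 2) := Real.exp_le_exp.2 (by linarith)
      _ = 2 := Real.exp_log (by norm_num)
  have hv0 : (0:ℝ) < v := by positivity
  have hvL : (v:ℝ) ≤ L := by nlinarith [sq_nonneg m]
  set u : ℝ := 1 - 3 * v / (4 * L) with hu
  have hu4 : 1/4 ≤ u := by
    have : 3 * v / (4 * L) ≤ 3/4 := by
      rw [div_le_iff₀ (by positivity)]; nlinarith
    linarith
  have hu0 : 0 < u := by linarith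
  have huL : u * L = L - 3 * v / 4 := by rw [hu]; field_simp
  have key : ∀ x : ℝ, gaussianPDFReal m v x * Real.exp (3 / (8 * L) * x^2) =
      ((Real.sqrt (2 * Real.pi * v))⁻¹ * Real.exp (3 / (8 * L) * m^2 / u)) *
        Real.exp (- (u / (2 * v)) * (x - m / u)^2) := by
    intro x
    rw [gaussianPDFReal, mul_assoc _ (Real.exp _) (Real.exp _), mul_assoc _ (Real.exp _) (Real.exp _),
      ← Real.exp_add, ← Real.exp_add]
    congr 2
    have hL' : 3 / (8 * L) = (1 - u) / (2 * v) := by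
      rw [hu]; field_simp; ring
    rw [hL']
    field_simp
    ring
  have hint : Integrable (fun x : ℝ => Real.exp (- (u / (2 * v)) * (x - m / u)^2)) :=
    (integrable_exp_neg_mul_sq (b := u / (2 * v)) (by positivity)).comp_sub_right (m / u)
  have hval : ∫ x : ℝ, Real.exp (- (u / (2 * v)) * (x - m / u)^2) =
      Real.sqrt (Real.pi / (u / (2 * v))) := by
    rw [integral_sub_right_eq_self (fun x : ℝ => Real.exp (- (u / (2 * v)) * x^2)) (m / u),
      integral_gaussian]
  constructor
  · rw [gaussianReal_of_var_ne_zero _ hv, gaussianPDF_def,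
      integrable_withDensity_iff_integrable_smul' (by fun_prop) (by simp)]
    simp only [ENNReal.toReal_ofReal (gaussianPDFReal_nonneg m v _), smul_eq_mul, key]
    exact hint.const_mul _
  · rw [integral_gaussianReal_eq_integral_smul hv]
    simp only [smul_eq_mul, key]
    rw [integral_const_mul, hval]
    have e1 : Real.pi / (u / (2 * v)) = (2 * Real.pi * v) * u⁻¹ := by field_simp
    rw [e1, Real.sqrt_mul (x := 2 * Real.pi * v) (by positivity) u⁻¹]
    have hs : Real.sqrt (2 * Real.pi * v) ≠ 0 := by positivity
    have e2 : ∀ a b c : ℝ, a ≠ 0 → a⁻¹ * b * (a * c) = b * c := by intros; field_simp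
    rw [e2 _ _ _ hs]
    set w := 1 / (4 * u) with hw
    have hw' : u⁻¹ = 4 * w := by rw [hw]; field_simp
    have hexp : 3 / (8 * L) * m^2 / u ≤ (1 - w) / 2 := by
      have : (1 - w) / 2 = (4 * u - 1) * L / (8 * u * L) := by rw [hw]; field_simp; ring
      rw [this]
      have : 3 / (8 * L) * m^2 / u = 3 * m^2 / (8 * u * L) := by field_simp
      rw [this]
      apply div_le_div_of_nonneg_right _ (by positivity)
      nlinarith
    have hw0 : 0 < w := by positivity
    have hwe : w ≤ Real.exp (w - 1) := by linarith [Real.add_one_le_exp (w - 1)]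
    have hsq : Real.sqrt (4 * w) ≤ 2 * Real.exp ((w - 1) / 2) := by
      apply Real.sqrt_le_iff.2 ⟨by positivity, ?_⟩
      rw [mul_pow, ← Real.exp_nat_mul]
      have : ((2:ℕ):ℝ) * ((w - 1) / 2) = w - 1 := by push_cast; ring
      rw [this]; linarith
    rw [hw']
    calc _ ≤ Real.exp ((1 - w) / 2) * (2 * Real.exp ((w - 1) / 2)) :=
          mul_le_mul (Real.exp_le_exp.2 hexp) hsq (by positivity) (by positivity)
      _ = 2 * Real.exp ((1 - w) / 2 + (w - 1) / 2) := by rw [Real.exp_add]; ring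
      _ = 2 := by ring_nf; simp

lemma aux_sq (m : ℝ) (v : ℝ≥0) :
    Integrable (fun x => x^2) (gaussianReal m v) ∧
    ∫ x, x^2 ∂(gaussianReal m v) = m^2 + v := by
  have hm : MemLp id 2 (gaussianReal m v) := memLp_id_gaussianReal 2
  refine ⟨hm.integrable_sq, ?_⟩
  have h := variance_eq_sub hm
  rw [variance_id_gaussianReal] at h
  simp at h
  linarith

lemma aux_dom
    {Ω : Type*} [MeasurableSpace Ω] (μ : Measure Ω) [IsProbabilityMeasure μ]
    (n : ℕ) (hn : 2 ≤ n)
    (X : Fin n → Ω → ℝ) (m : Fin n → ℝ) (v : Fin n → ℝ≥0)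
    (hmeas : ∀ i, Measurable (X i))
    (hlaw : ∀ i, μ.map (X i) = gaussianReal (m i) (v i))
    (L : ℝ) (hL : 0 < L) (h : ∀ i, (m i)^2 + v i ≤ L) :
    ∃ g : Ω → ℝ, Integrable g μ ∧ (∀ i ω, (X i ω)^2 ≤ g ω) ∧
      ∫ ω, g ω ∂μ ≤ 4 * L * Real.log n := by
  have hl2 := Real.log_two_gt_d9
  by_cases hn4 : n < 4
  · have hi : ∀ i, Integrable (fun ω => (X i ω)^2) μ := fun i => by
      have := (aux_sq (m i) (v i)).1
      rw [← hlaw i] at this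
      exact this.comp_measurable (hmeas i)
    have hv : ∀ i, ∫ ω, (X i ω)^2 ∂μ ≤ L := fun i => by
      have := (aux_sq (m i) (v i)).2
      rw [← hlaw i, integral_map (hmeas i).aemeasurable (by fun_prop)] at this
      rw [this]; exact h i
    refine ⟨fun ω => ∑ i, (X i ω)^2, integrable_finsetSum _ (fun i _ => hi i), ?_, ?_⟩
    · intro i ω
      exact Finset.single_le_sum (f := fun i => (X i ω)^2) (fun _ _ => sq_nonneg _)
        (Finset.mem_univ i)
    · rw [integral_finsetSum _ (fun i _ => hi i)]
      have h1 : ∑ i, ∫ ω, (X i ω)^2 ∂μ ≤ n * L := by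
        calc _ ≤ ∑ i : Fin n, L := Finset.sum_le_sum (fun i _ => hv i)
          _ = n * L := by simp
      have h2 : (n:ℝ) ≤ 4 * Real.log n := by
        interval_cases n
        · push_cast; linarith
        · have : Real.log (2^3) ≤ Real.log (3^2) := Real.log_le_log (by norm_num) (by norm_num)
          rw [Real.log_pow, Real.log_pow] at this
          push_cast at this ⊢; linarith
      nlinarith
  · push Not at hn4
    set t := 3 / (8 * L) with ht
    have ht0 : 0 < t := by positivity
    have hi : ∀ i, Integrable (fun ω => Real.exp (t * (X i ω)^2)) μ := fun i => by
      have := (aux_exp (m i) (v i) L hL (h i)).1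
      rw [← hlaw i] at this
      exact this.comp_measurable (hmeas i)
    have hv : ∀ i, ∫ ω, Real.exp (t * (X i ω)^2) ∂μ ≤ 2 := fun i => by
      have := (aux_exp (m i) (v i) L hL (h i)).2
      rw [← hlaw i, integral_map (hmeas i).aemeasurable (by fun_prop)] at this
      exact this
    have hn0 : (4:ℝ) ≤ n := by exact_mod_cast hn4
    have hK : (0:ℝ) < 2 * n := by linarith
    have his := integrable_finsetSum Finset.univ (fun i _ => hi i)
    refine ⟨fun ω => t⁻¹ * ((Real.log (2 * n) - 1) +
      (2 * n : ℝ)⁻¹ * ∑ i, Real.exp (t * (X i ω)^2)),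
      ((integrable_const _).add (his.const_mul _)).const_mul _, ?_, ?_⟩
    · intro i ω
      have h1 := Finset.single_le_sum (f := fun i => Real.exp (t * (X i ω)^2))
        (fun _ _ => (Real.exp_pos _).le) (Finset.mem_univ i)
      have h2 := Real.add_one_le_exp (t * (X i ω)^2 - Real.log (2 * n))
      rw [Real.exp_sub, Real.exp_log hK] at h2
      have h3 := mul_le_mul_of_nonneg_left h1 (inv_pos.2 hK).le
      rw [div_eq_inv_mul] at h2
      beta_reduce
      rw [← div_eq_inv_mul, le_div_iff₀ ht0]
      beta_reduce at h3
      linarith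
    · rw [integral_const_mul, integral_add (integrable_const _) (his.const_mul _),
        integral_const_mul, integral_finsetSum _ (fun i _ => hi i)]
      have h1 : ∑ i, ∫ ω, Real.exp (t * (X i ω)^2) ∂μ ≤ 2 * n := by
        calc _ ≤ ∑ i : Fin n, (2:ℝ) := Finset.sum_le_sum (fun i _ => hv i)
          _ = 2 * n := by simp [mul_comm]
      have h3 := mul_le_mul_of_nonneg_left h1 (inv_pos.2 hK).le
      rw [inv_mul_cancel₀ hK.ne'] at h3
      have h4 : Real.log (2 * n) ≤ 3 / 2 * Real.log n := by
        have : Real.log (2^2) ≤ Real.log n := Real.log_le_log (by norm_num) (by linarith)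
        rw [Real.log_pow] at this
        rw [Real.log_mul (by norm_num) (by linarith)]
        push_cast at this; linarith
      simp only [integral_const, probReal_univ, one_smul]
      rw [← div_eq_inv_mul, div_le_iff₀ ht0]
      have : 4 * L * Real.log n * t = 3 / 2 * Real.log n := by rw [ht]; field_simp; ring
      rw [this]; linarith

/-- **Maximum of (not necessarily independent) Gaussians** (Proposition A.2).
If `X₁, …, Xₙ` (`n ≥ 2`) are Gaussian random variables on a common probability space with
means `m i` and variances `v i`, and `λ = maxᵢ √(mᵢ² + vᵢ)`, then
`E[maxᵢ Xᵢ²] ≤ 4 λ² log n` and `E[maxᵢ |Xᵢ|] ≤ 2 λ √(log n)`. -/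
theorem gaussian_max_sq_le
    {Ω : Type*} [MeasurableSpace Ω] (μ : Measure Ω) [IsProbabilityMeasure μ]
    (n : ℕ) (hn : 2 ≤ n)
    (X : Fin n → Ω → ℝ) (m : Fin n → ℝ) (v : Fin n → ℝ≥0)
    (hmeas : ∀ i, Measurable (X i))
    (hlaw : ∀ i, μ.map (X i) = gaussianReal (m i) (v i))
    (lam : ℝ) (hlam : lam = ⨆ i, Real.sqrt ((m i)^2 + (v i : ℝ))) :
    (∫ ω, (⨆ i, (X i ω)^2) ∂μ) ≤ 4 * lam^2 * Real.log n ∧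
    (∫ ω, (⨆ i, |X i ω|) ∂μ) ≤ 2 * lam * Real.sqrt (Real.log n) := by
  have : Nonempty (Fin n) := ⟨⟨0, by omega⟩⟩
  have hlam0 : 0 ≤ lam := by rw [hlam]; exact Real.iSup_nonneg (fun i => Real.sqrt_nonneg _)
  have hle : ∀ i, (m i)^2 + v i ≤ lam^2 := fun i => by
    have : Real.sqrt ((m i)^2 + (v i : ℝ)) ≤ lam := by
      rw [hlam]
      exact le_ciSup (f := fun i => Real.sqrt ((m i)^2 + (v i : ℝ))) (Set.finite_range _).bddAbove i
    exact (Real.sqrt_le_left hlam0).1 this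
  have hlog : 0 < Real.log n := Real.log_pos (by exact_mod_cast hn)
  have main : ∀ l, lam < l → (∫ ω, (⨆ i, (X i ω)^2) ∂μ) ≤ 4 * l^2 * Real.log n ∧
      (∫ ω, (⨆ i, |X i ω|) ∂μ) ≤ 2 * l * Real.sqrt (Real.log n) := by
    intro l hl
    have hl0 : 0 < l := by linarith
    obtain ⟨g, hg, hd, hi⟩ := aux_dom μ n hn X m v hmeas hlaw (l^2) (by positivity)
      (fun i => (hle i).trans (by nlinarith))
    constructor
    · refine le_trans (integral_mono_of_nonneg ?_ hg ?_) hi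
      · exact Filter.Eventually.of_forall fun ω => Real.iSup_nonneg (fun i => sq_nonneg _)
      · exact Filter.Eventually.of_forall fun ω => ciSup_le (fun i => hd i ω)
    · set c := 2 * l * Real.sqrt (Real.log n) with hc
      have hc0 : 0 < c := by positivity
      have hcc : c^2 = 4 * l^2 * Real.log n := by
        rw [hc, mul_pow, Real.sq_sqrt hlog.le]; ring
      have hG : Integrable (fun ω => (2 * c)⁻¹ * (g ω + c^2)) μ :=
        (hg.add (integrable_const _)).const_mul _
      refine le_trans (integral_mono_of_nonneg ?_ hG ?_) ?_
      · exact Filter.Eventually.of_forall fun ω => Real.iSup_nonneg (fun i => abs_nonneg _)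
      · refine Filter.Eventually.of_forall fun ω => ciSup_le (fun i => ?_)
        simp only
        rw [← div_eq_inv_mul, le_div_iff₀ (by positivity)]
        nlinarith [hd i ω, sq_abs (X i ω), sq_nonneg (|X i ω| - c)]
      · rw [integral_const_mul, integral_add hg (integrable_const _)]
        simp only [integral_const, probReal_univ, one_smul]
        rw [← div_eq_inv_mul, div_le_iff₀ (by positivity)]
        nlinarith
  constructor
  · have ht : Filter.Tendsto (fun l : ℝ => 4 * l^2 * Real.log n) (nhdsWithin lam (Set.Ioi lam))
        (nhds (4 * lam^2 * Real.log n)) :=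
      (Continuous.tendsto (by fun_prop) lam).mono_left nhdsWithin_le_nhds
    exact ge_of_tendsto ht (by filter_upwards [self_mem_nhdsWithin] with l hl using (main l hl).1)
  · have ht : Filter.Tendsto (fun l : ℝ => 2 * l * Real.sqrt (Real.log n))
        (nhdsWithin lam (Set.Ioi lam)) (nhds (2 * lam * Real.sqrt (Real.log n))) :=
      (Continuous.tendsto (by fun_prop) lam).mono_left nhdsWithin_le_nhds
    exact ge_of_tendsto ht (by filter_upwards [self_mem_nhdsWithin] with l hl using (main l hl).2)
end
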